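/- arXiv:2510.01572 — 2 statements merged into one kernel-verified Lean document; each statement's English description precedes it below -/
import Mathlib

section
/- For all integers n ≥ 0, a_{14}(27n + 4) ≡ a_{14}(3n) (mod 3). -/
/-- The set of `k`-colored-odd partitions of `n`: multisets of pairs `(m, c)` with
`m` a positive integer and `c ∈ {1, …, k}`, such that `c = 1` whenever `m` is even,
and the parts `m` sum (with multiplicity) to `n`. -/
def coloredOddPartitions (k n : ℕ) : Set (Multiset (ℕ × ℕ)) :=
  {s | (∀ p ∈ s, 0 < p.1 ∧ 1 ≤ p.2 ∧ p.2 ≤ k ∧ (Even p.1 → p.2 = 1)) ∧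
    (s.map Prod.fst).sum = n}

/-- `a k n` is the number of `k`-colored-odd partitions of `n`. -/
noncomputable def a (k n : ℕ) : ℕ := Nat.card (coloredOddPartitions k n)

namespace Stmt18
open PowerSeries Finset


section qbinom
variable {R : Type*} [CommRing R]

/-- Triangular numbers `n (n-1) / 2`. -/
def tri : ℕ → ℕ
  | 0 => 0
  | n + 1 => tri n + n

lemma tri_sq (n : ℕ) : 2 * tri n + n = n ^ 2 := by
  induction n with
  | zero => simp [tri]
  | succ n ih => simp only [tri]; nlinarith

/-- Gaussian binomials. -/
def G (Q : R) : ℕ → ℕ → R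
  | _, 0 => 1
  | 0, _ + 1 => 0
  | n + 1, k + 1 => G Q n k + Q ^ (k + 1) * G Q n (k + 1)

lemma G_zero (Q : R) (n : ℕ) : G Q n 0 = 1 := by cases n <;> simp [G]

lemma G_lt (Q : R) (n k : ℕ) (h : n < k) : G Q n k = 0 := by
  induction n generalizing k with
  | zero => cases k with
    | zero => omega
    | succ k => simp [G]
  | succ n ih => cases k with
    | zero => omega
    | succ k => simp [G, ih k (by omega), ih (k+1) (by omega)]

lemma qbinom (Q y z : R) (n : ℕ) : ∏ i ∈ range n, (y + z * Q ^ i) =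
    ∑ k ∈ range (n + 1), Q ^ tri k * G Q n k * z ^ k * y ^ (n - k) := by
  induction n generalizing z with
  | zero => simp [tri, G]
  | succ n ih =>
    rw [prod_range_succ', sum_range_succ']
    have h1 : ∏ k ∈ range n, (y + z * Q ^ (k + 1)) = ∏ k ∈ range n, (y + (z * Q) * Q ^ k) := by
      apply prod_congr rfl; intros; ring
    rw [h1, ih]
    have h2 : ∑ k ∈ range (n + 1), Q ^ tri (k + 1) * G Q (n + 1) (k + 1) * z ^ (k + 1) * y ^ (n + 1 - (k + 1))
       = (∑ k ∈ range (n + 1), Q ^ tri k * G Q n k * (z * Q) ^ k * y ^ (n - k)) * z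
        + ∑ k ∈ range (n + 1), Q ^ tri (k + 1) * G Q n (k + 1) * (z * Q) ^ (k + 1) * y ^ (n - k) := by
      rw [sum_mul, ← sum_add_distrib]
      apply sum_congr rfl
      intro k _
      rw [Nat.add_sub_add_right]
      simp only [tri, G]
      ring
    have h3 : (∑ k ∈ range (n + 1), Q ^ tri k * G Q n k * (z * Q) ^ k * y ^ (n - k)) * y
       = ∑ k ∈ range (n + 1), Q ^ tri (k + 1) * G Q n (k + 1) * (z * Q) ^ (k + 1) * y ^ (n - k)
         + y ^ (n + 1) := by
      rw [sum_range_succ', sum_range_succ _ n, G_lt Q n (n+1) (by omega), add_mul, sum_mul]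
      simp only [G_zero, tri]
      have : ∀ k ∈ range n, Q ^ (tri k + k) * G Q n (k + 1) * (z * Q) ^ (k + 1) * y ^ (n - (k + 1)) * y
         = Q ^ (tri k + k) * G Q n (k + 1) * (z * Q) ^ (k + 1) * y ^ (n - k) := by
        intro k hk
        have : n - k = (n - (k+1)) + 1 := by have := mem_range.1 hk; omega
        rw [this]; ring
      rw [sum_congr rfl this]
      simp; ring
    rw [h2]
    simp only [pow_zero, mul_one, tri, G_zero, one_mul, Nat.sub_zero, mul_add, h3]
    ring

/-- q-Pochhammer. -/
def qp (Q : R) (n : ℕ) : R := ∏ i ∈ range n, (1 - Q ^ (i + 1))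

lemma qp_succ (Q : R) (n : ℕ) : qp Q (n + 1) = qp Q n * (1 - Q ^ (n + 1)) := prod_range_succ _ _

lemma G_self (Q : R) (n : ℕ) : G Q n n = 1 := by
  induction n with
  | zero => simp [G]
  | succ n ih => simp [G, ih, G_lt Q n (n+1) (by omega)]

lemma G_qp (Q : R) (a b : ℕ) : G Q (a + b) a * qp Q a * qp Q b = qp Q (a + b) := by
  induction a generalizing b with
  | zero => simp [G_zero, qp]
  | succ a iha => induction b with
    | zero => simp [G_self, qp]
    | succ b ihb =>
      have h1 := iha (b + 1)
      have e : a + 1 + b = a + (b + 1) := by ring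
      rw [e] at ihb
      have e2 : a + 1 + (b + 1) = (a + (b + 1)) + 1 := by ring
      rw [e2, qp_succ Q (a + (b+1)), G]
      calc _ = (G Q (a + (b + 1)) a * qp Q a * qp Q (b+1)) * (1 - Q ^ (a+1))
            + Q ^ (a + 1) * (G Q (a + (b + 1)) (a + 1) * qp Q (a + 1) * qp Q b) * (1 - Q ^ (b+1)) := by
              rw [qp_succ Q a, qp_succ Q b]; ring
        _ = _ := by rw [h1, ihb]; ring

end qbinom

section lim
variable {R : Type*} [CommRing R]

/-- X-adic convergence. -/
def Lim (s : ℕ → R⟦X⟧) (L : R⟦X⟧) : Prop := ∀ d, ∃ N0, ∀ N ≥ N0, X ^ d ∣ s N - L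

lemma eq_of_dvd {A B : R⟦X⟧} (h : ∀ d, X ^ d ∣ A - B) : A = B := by
  ext d
  have := (X_pow_dvd_iff.1 (h (d + 1))) d (by omega)
  rwa [map_sub, sub_eq_zero] at this

lemma Lim.unique {s : ℕ → R⟦X⟧} {A B : R⟦X⟧} (h : Lim s A) (h' : Lim s B) : A = B := by
  apply eq_of_dvd
  intro d
  obtain ⟨N, hN⟩ := h d
  obtain ⟨M, hM⟩ := h' d
  have := dvd_sub (hM (max N M) (le_max_right _ _)) (hN (max N M) (le_max_left _ _))
  convert this using 1; ring

lemma Lim.mul {s t : ℕ → R⟦X⟧} {A B : R⟦X⟧} (h : Lim s A) (h' : Lim t B) :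
    Lim (fun n => s n * t n) (A * B) := by
  intro d
  obtain ⟨N, hN⟩ := h d
  obtain ⟨M, hM⟩ := h' d
  refine ⟨max N M, fun n hn => ?_⟩
  have := dvd_add ((hN n (le_trans (le_max_left _ _) hn)).mul_right (t n))
    ((hM n (le_trans (le_max_right _ _) hn)).mul_left A)
  convert this using 1; ring

lemma Lim.add {s t : ℕ → R⟦X⟧} {A B : R⟦X⟧} (h : Lim s A) (h' : Lim t B) :
    Lim (fun n => s n + t n) (A + B) := by
  intro d
  obtain ⟨N, hN⟩ := h d
  obtain ⟨M, hM⟩ := h' d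
  refine ⟨max N M, fun n hn => ?_⟩
  have := dvd_add (hN n (le_trans (le_max_left _ _) hn)) (hM n (le_trans (le_max_right _ _) hn))
  convert this using 1; ring

lemma Lim.const (A : R⟦X⟧) : Lim (fun _ => A) A := fun d => ⟨0, fun n _ => by simp⟩

lemma Lim.pow {s : ℕ → R⟦X⟧} {A : R⟦X⟧} (h : Lim s A) (k : ℕ) :
    Lim (fun n => s n ^ k) (A ^ k) := by
  induction k with
  | zero => simpa using Lim.const 1
  | succ k ih => simpa only [pow_succ] using ih.mul h

lemma Lim.comp {s : ℕ → R⟦X⟧} {A : R⟦X⟧} (h : Lim s A) (g : ℕ → ℕ) (hg : ∀ n, n ≤ g n) :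
    Lim (fun n => s (g n)) A := by
  intro d
  obtain ⟨N, hN⟩ := h d
  exact ⟨N, fun n hn => hN _ (le_trans hn (hg n))⟩

lemma Lim.of_mul {s t : ℕ → R⟦X⟧} {A B : R⟦X⟧} (h : Lim (fun n => s n * t n) (A * B)) (h' : Lim t B)
    (hB : IsUnit B) : Lim s A := by
  intro d
  obtain ⟨N, hN⟩ := h d
  obtain ⟨M, hM⟩ := h' d
  refine ⟨max N M, fun n hn => ?_⟩
  have := dvd_sub (hN n (le_trans (le_max_left _ _) hn))
    ((hM n (le_trans (le_max_right _ _) hn)).mul_left (s n))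
  rw [← hB.dvd_mul_right]
  convert this using 1; ring

lemma Lim.congr {s t : ℕ → R⟦X⟧} {A : R⟦X⟧} (h : Lim s A)
    (h' : ∀ d, ∃ N0, ∀ N ≥ N0, X ^ d ∣ t N - s N) : Lim t A := by
  intro d
  obtain ⟨N, hN⟩ := h d
  obtain ⟨M, hM⟩ := h' d
  refine ⟨max N M, fun n hn => ?_⟩
  have := dvd_add (hN n (le_trans (le_max_left _ _) hn)) (hM n (le_trans (le_max_right _ _) hn))
  convert this using 1; ring

/-- finite Euler product -/
noncomputable def E (R : Type*) [CommRing R] (k N : ℕ) : R⟦X⟧ := qp (X ^ k) N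

lemma E_step {k : ℕ} (hk : 1 ≤ k) {d N M : ℕ} (hN : d ≤ N) (hNM : N ≤ M) :
    X ^ d ∣ E R k M - E R k N := by
  induction M, hNM using Nat.le_induction with
  | base => simp
  | succ M hM ih =>
    have e : E R k (M+1) - E R k N = (E R k M - E R k N) - X ^ (k * (M+1)) * E R k M := by
      simp only [E, qp_succ]; ring
    rw [e]
    refine dvd_sub ih (Dvd.dvd.mul_right (pow_dvd_pow _ ?_) _)
    nlinarith

lemma E_congr {k : ℕ} (hk : 1 ≤ k) {d N M : ℕ} (hN : d ≤ N) (hM : d ≤ M) :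
    X ^ d ∣ E R k M - E R k N := by
  have := dvd_sub (E_step (R := R) hk le_rfl hM) (E_step (R := R) hk le_rfl hN)
  convert this using 1; ring

/-- infinite Euler product -/
noncomputable def f (R : Type*) [CommRing R] (k : ℕ) : R⟦X⟧ :=
  PowerSeries.mk fun d => coeff d (E R k (d + 1))

lemma E_lim {k : ℕ} (hk : 1 ≤ k) : Lim (E R k) (f R k) := by
  intro d
  refine ⟨d, fun N hN => X_pow_dvd_iff.2 fun m hm => ?_⟩
  have := X_pow_dvd_iff.1 (E_congr (R := R) hk (le_refl (m+1)) (show m + 1 ≤ N by omega)) m (by omega)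
  simpa [f] using this

lemma E_unit {k : ℕ} (hk : 1 ≤ k) (N : ℕ) : IsUnit (E R k N) := by
  rw [isUnit_iff_constantCoeff]
  have : constantCoeff (E R k N) = 1 := by
    simp only [E, qp, map_prod]
    apply prod_eq_one
    intro i _
    have : k ≠ 0 := by omega
    simp [← pow_mul, this]
  rw [this]; exact isUnit_one

lemma f_unit {k : ℕ} (hk : 1 ≤ k) : IsUnit (f R k) := by
  have h := E_unit (R := R) hk 1
  rw [isUnit_iff_constantCoeff] at h ⊢
  have : constantCoeff (f R k) = constantCoeff (E R k 1) := by
    rw [← coeff_zero_eq_constantCoeff_apply, f, coeff_mk]; simp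
  rwa [this]

/-- theta terms -/
noncomputable def th (e : R⟦X⟧) (t r s n : ℕ) : R⟦X⟧ :=
  e ^ n * X ^ (t * tri n + r * n) + e ^ (n + 1) * X ^ (t * tri (n + 1) + s * (n + 1))

lemma tri_add (a b : ℕ) : tri (a + b) = tri a + tri b + a * b := by
  have h1 := tri_sq a; have h2 := tri_sq b; have h3 := tri_sq (a+b); nlinarith

lemma jtp_low (e : R⟦X⟧) (he : e ^ 2 = 1) (r s N M : ℕ) :
    ∏ i ∈ range N, (X ^ ((r + s) * (N + M)) + e * X ^ r * (X ^ (r + s)) ^ (i + M)) =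
      e ^ N * X ^ ((r + s) * tri N + r * N + M * (r + s) * N) *
        (∏ m ∈ range N, (1 + e * X ^ ((r+s) * m + s))) := by
  induction N generalizing M with
  | zero => simp [tri]
  | succ N ih =>
    rw [prod_range_succ', prod_range_succ _ N]
    have h := ih (M + 1)
    have e1 : ∏ k ∈ range N, (X ^ ((r + s) * (N + 1 + M)) + e * X ^ r * (X ^ (r + s)) ^ (k + 1 + M))
      = ∏ i ∈ range N, (X ^ ((r + s) * (N + (M + 1))) + e * X ^ r * (X ^ (r + s)) ^ (i + (M + 1))) := by
      apply prod_congr rfl; intro i _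
      rw [show N + 1 + M = N + (M + 1) by ring, show i + 1 + M = i + (M + 1) by ring]
    rw [e1, h]
    have e2 : (X ^ ((r + s) * (N + 1 + M)) + e * X ^ r * (X ^ (r + s)) ^ (0 + M) : R⟦X⟧)
       = e * X ^ (r + (r + s) * M) * (1 + e * X ^ ((r+s) * N + s)) := by
      have : e * X ^ (r + (r + s) * M) * (1 + e * X ^ ((r+s) * N + s)) =
        e * X ^ (r + (r + s) * M) + e ^ 2 * X ^ ((r + s) * (N + 1 + M)) := by ring
      rw [this, he]; ring
    rw [e2]
    simp only [tri]
    ring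

lemma jtp_left (e : R⟦X⟧) (he : e ^ 2 = 1) (r s N : ℕ) :
    ∏ i ∈ range (2 * N), (X ^ ((r + s) * N) + e * X ^ r * (X ^ (r + s)) ^ i) =
    (e ^ N * X ^ ((r+s) * N * N + (r + s) * tri N + r * N)) *
      ((∏ m ∈ range N, (1 + e * X ^ ((r+s) * m + r))) *
        (∏ m ∈ range N, (1 + e * X ^ ((r+s) * m + s)))) := by
  rw [two_mul, prod_range_add]
  have h1 : ∏ i ∈ range N, (X ^ ((r + s) * N) + e * X ^ r * (X ^ (r + s)) ^ (N + i)) =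
      X ^ ((r+s) * N * N) * (∏ m ∈ range N, (1 + e * X ^ ((r+s) * m + r))) := by
    have : (X : R⟦X⟧) ^ ((r+s) * N * N) = ∏ m ∈ range N, X ^ ((r+s) * N) := by
      simp [← pow_mul]
    rw [this, ← prod_mul_distrib]
    apply prod_congr rfl; intro i _; ring
  have h2 := jtp_low e he r s N 0
  simp only [add_zero, zero_mul] at h2
  rw [h1, h2]; ring

lemma jtp_fin (e : R⟦X⟧) (he : e ^ 2 = 1) (r s N : ℕ) :
    (∏ m ∈ range N, (1 + e * X ^ ((r+s) * m + r))) *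
        (∏ m ∈ range N, (1 + e * X ^ ((r+s) * m + s))) =
    ∑ n ∈ range (N + 1), e ^ n * X ^ ((r + s) * tri n + r * n) * G (X ^ (r + s)) (2 * N) (N + n)
    + ∑ n ∈ range N, e ^ (n + 1) * X ^ ((r + s) * tri (n + 1) + s * (n + 1))
        * G (X ^ (r + s)) (2 * N) (N - 1 - n) := by
  have hb := qbinom ((X : R⟦X⟧) ^ (r + s)) (X ^ ((r + s) * N)) (e * X ^ r) (2 * N)
  rw [jtp_left e he] at hb
  have heu : IsUnit (e ^ N) := (IsUnit.of_mul_eq_one e (by rw [← sq, he])).pow N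
  apply (X_pow_mul_injective (R := R) (k := (r+s) * N * N + (r + s) * tri N + r * N))
  apply heu.mul_left_cancel
  simp only
  rw [← mul_assoc, hb, show 2 * N + 1 = N + (N + 1) by ring, sum_range_add, mul_add, mul_add, add_comm]
  congr 1
  · rw [mul_sum, mul_sum]
    apply sum_congr rfl
    intro n hn
    have hn' := mem_range.1 hn
    obtain ⟨k, rfl⟩ : ∃ k, N = n + k := ⟨N - n, by omega⟩
    rw [show 2 * (n + k) - (n + k + n) = k by omega, tri_add (n + k) n]
    ring
  · rw [mul_sum, mul_sum, ← sum_range_reflect]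
    apply sum_congr rfl
    intro n hn
    have hn' := mem_range.1 hn
    obtain ⟨k, rfl⟩ : ∃ k, N = n + 1 + k := ⟨N - (n + 1), by omega⟩
    rw [show n + 1 + k - 1 - n = k by omega, show 2 * (n + 1 + k) - k = 2 * (n + 1) + k by omega,
      tri_add (n + 1) k]
    have h2 := tri_sq (n + 1)
    have e1 : e ^ (n + 1 + k) * e ^ (n + 1) = e ^ k := by
      rw [show e ^ (n + 1 + k) * e ^ (n + 1) = (e ^ 2) ^ (n + 1) * e ^ k by ring, he]; simp
    have e2 : (r + s) * tri k + r * k + (r + s) * (n + 1 + k) * (2 * (n + 1) + k) =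
      ((r + s) * (n + 1 + k) * (n + 1 + k) + (r + s) * (tri (n + 1) + tri k + (n + 1) * k) +
        r * (n + 1 + k)) + ((r + s) * tri (n + 1) + s * (n + 1)) := by
      nlinarith
    calc _ = e ^ k * X ^ ((r + s) * tri k + r * k + (r + s) * (n + 1 + k) * (2 * (n + 1) + k))
           * G (X ^ (r + s)) (2 * (n + 1 + k)) k := by ring
      _ = _ := by rw [e2, ← e1]; ring

lemma G_congr {t : ℕ} (ht : 1 ≤ t) {d N a b : ℕ} (hab : a + b = 2 * N) (ha : d ≤ a) (hb : d ≤ b) :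
    X ^ d ∣ E R t N * G (X ^ t) (2 * N) a - 1 := by
  have h := G_qp ((X : R⟦X⟧) ^ t) a b
  rw [hab] at h
  change _ * E R t a * E R t b = E R t (2 * N) at h
  have h1 : X ^ d ∣ E R t a - E R t N := E_congr ht (by omega) (by omega)
  have h2 : X ^ d ∣ E R t b - E R t N := E_congr ht (by omega) (by omega)
  have h3 : X ^ d ∣ E R t (2 * N) - E R t N := E_congr ht (by omega) (by omega)
  rw [← (E_unit (R := R) ht N).dvd_mul_right]
  set g := G ((X : R⟦X⟧) ^ t) (2 * N) a
  have : (E R t N * g - 1) * E R t N = (E R t (2 * N) - E R t N)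
     - g * (E R t a - E R t N) * E R t b - g * E R t N * (E R t b - E R t N) := by
    rw [← h]; ring
  rw [this]
  exact dvd_sub (dvd_sub h3 ((h1.mul_left _).mul_right _)) (h2.mul_left _)

lemma le_tri (n : ℕ) : n ≤ tri n + 1 := by
  cases n with
  | zero => simp
  | succ n => simp [tri]

/-- product side -/
noncomputable def JP (e : R⟦X⟧) (r s N : ℕ) : R⟦X⟧ :=
  E R (r + s) N * ((∏ m ∈ range N, (1 + e * X ^ ((r+s) * m + r))) *
        (∏ m ∈ range N, (1 + e * X ^ ((r+s) * m + s))))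

/-- theta partial sum -/
noncomputable def TH (e : R⟦X⟧) (r s N : ℕ) : R⟦X⟧ := ∑ n ∈ range N, th e (r + s) r s n

lemma term_congr {t : ℕ} (ht : 1 ≤ t) (c : R⟦X⟧) {d N a n x : ℕ} (hx : n ≤ x + 1) (hN : 2 * d + 4 ≤ N)
    (ha : N ≤ a + (n + 1)) (ha' : a ≤ N + n) (ha2 : a ≤ 2 * N) :
    X ^ d ∣ E R t N * (c * X ^ x * G (X ^ t) (2 * N) a) - c * X ^ x := by
  have e1 : E R t N * (c * X ^ x * G (X ^ t) (2 * N) a) - c * X ^ x =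
    c * X ^ x * (E R t N * G (X ^ t) (2 * N) a - 1) := by ring
  rw [e1]
  by_cases h : d ≤ x
  · exact ((pow_dvd_pow X h).mul_left c).mul_right _
  · exact (G_congr ht (b := 2 * N - a) (by omega) (by omega) (by omega)).mul_left _

lemma jtp (e : R⟦X⟧) (he : e ^ 2 = 1) (r s : ℕ) (hrs : 1 ≤ r + s) {A : R⟦X⟧} (h : Lim (JP e r s) A) :
    Lim (TH e r s) A := by
  apply h.congr
  intro d
  refine ⟨2 * d + 4, fun N hN => ?_⟩
  rw [dvd_sub_comm]
  rw [JP, jtp_fin e he, TH]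
  simp only [th]
  rw [sum_add_distrib, mul_add, mul_sum, mul_sum, sum_range_succ]
  have hx : ∀ n, n ≤ (r + s) * tri n + 1 := fun n => by
    have := le_tri n; nlinarith
  have h1 : X ^ d ∣ ∑ n ∈ range N, (E R (r+s) N * (e ^ n * X ^ ((r + s) * tri n + r * n) * G (X ^ (r + s)) (2 * N) (N + n))
     - e ^ n * X ^ ((r + s) * tri n + r * n)) := by
    apply dvd_sum
    intro n hn
    have := mem_range.1 hn
    apply term_congr hrs (n := n) _ _ hN <;> try omega
    have := hx n; omega
  have h2 : X ^ d ∣ ∑ n ∈ range N, (E R (r+s) N * (e ^ (n+1) * X ^ ((r + s) * tri (n+1) + s * (n+1)) * G (X ^ (r + s)) (2 * N) (N - 1 - n))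
     - e ^ (n+1) * X ^ ((r + s) * tri (n+1) + s * (n+1))) := by
    apply dvd_sum
    intro n hn
    have := mem_range.1 hn
    apply term_congr hrs (n := n + 1) _ _ hN <;> try omega
    have := hx (n+1); omega
  have h3 : X ^ d ∣ E R (r+s) N * (e ^ N * X ^ ((r + s) * tri N + r * N) * G (X ^ (r + s)) (2 * N) (N + N)) := by
    apply Dvd.dvd.mul_left
    apply Dvd.dvd.mul_right
    apply Dvd.dvd.mul_left
    apply pow_dvd_pow
    have := hx N; omega
  rw [sum_sub_distrib] at h1 h2
  convert dvd_add (dvd_add h1 h2) h3 using 1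
  ring

end lim

abbrev K := ZMod 3
abbrev S3 := (ZMod 3)⟦X⟧

instance charS3 : CharP S3 3 :=
  charP_of_injective_ringHom (f := (C : ZMod 3 →+* S3)) C_injective 3

lemma three_eq : (3 : S3) = 0 := by
  exact_mod_cast CharP.cast_eq_zero S3 3

lemma cube_coeff (B : S3) (n : ℕ) : coeff n (B ^ 3) = if 3 ∣ n then coeff (n / 3) B else 0 := by
  obtain ⟨C, hC⟩ : X ^ (n + 1) ∣ B - (trunc (n + 1) B : S3) := by
    rw [X_pow_dvd_iff]; intro m hm
    simp [coeff_trunc, hm]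
  have hB : B = (trunc (n + 1) B : S3) + X ^ (n + 1) * C := by rw [← hC]; ring
  have h1 : B ^ 3 = (((trunc (n + 1) B) ^ 3 : Polynomial (ZMod 3)) : S3) + X ^ (n + 1) * (X ^ (2 * (n+1)) * C ^ 3) := by
    conv_lhs => rw [hB]
    rw [add_pow_char]
    push_cast; ring
  rw [h1, map_add, coeff_X_pow_mul', if_neg (by omega), add_zero, ← ZMod.expand_card,
    Polynomial.coeff_coe, Polynomial.coeff_expand (by norm_num)]
  split_ifs with h
  · rw [coeff_trunc, if_pos (by omega)]
  · rfl

lemma dis0 (A B C : S3) (n : ℕ) : coeff (3 * n) (A ^ 3 + X * B ^ 3 + X ^ 2 * C ^ 3) = coeff n A := by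
  rw [map_add, map_add, ← pow_one X, ← pow_mul]
  simp only [coeff_X_pow_mul', cube_coeff]
  split_ifs <;> first | omega | simp

lemma dis1 (A B C : S3) (n : ℕ) : coeff (3 * n + 1) (A ^ 3 + X * B ^ 3 + X ^ 2 * C ^ 3) = coeff n B := by
  rw [map_add, map_add, ← pow_one X, ← pow_mul]
  simp only [coeff_X_pow_mul', cube_coeff]
  split_ifs <;> first | omega | simp

lemma prod_mul_range {M : Type*} [CommMonoid M] (g : ℕ → M) (c N : ℕ) :
    ∏ i ∈ range (c * N), g i = ∏ m ∈ range N, ∏ j ∈ range c, g (c * m + j) := by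
  induction N with
  | zero => simp
  | succ N ih => rw [mul_add, mul_one, prod_range_add, ih, prod_range_succ]

lemma sum_mul_range {M : Type*} [AddCommMonoid M] (g : ℕ → M) (c N : ℕ) :
    ∑ i ∈ range (c * N), g i = ∑ m ∈ range N, ∑ j ∈ range c, g (c * m + j) := by
  induction N with
  | zero => simp
  | succ N ih => rw [mul_add, mul_one, sum_range_add, ih, sum_range_succ]

lemma E_cube (k N : ℕ) : E K k N ^ 3 = E K (3 * k) N := by
  simp only [E, qp]
  rw [← prod_pow]
  apply prod_congr rfl; intro i _
  rw [sub_pow_char]; ring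

lemma f_cube (k : ℕ) (hk : 1 ≤ k) : f K k ^ 3 = f K (3 * k) := by
  have h := (E_lim (R := K) hk).pow 3
  simp only [E_cube] at h
  exact h.unique (E_lim (by omega))

lemma E_eq (k N : ℕ) : E K k N = ∏ i ∈ range N, (1 - X ^ (k * i + k)) := by
  simp only [E, qp]
  apply prod_congr rfl; intro i _; ring

variable {u v ui vi : S3}

lemma limP (hu : u = f K 1) (hv : v = f K 2) (hvi : v * vi = 1) :
    Lim (JP (-1 : S3) 1 1) (u ^ 2 * vi) := by
  have hE := E_lim (R := K) (k := 2) (by omega)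
  rw [← hv] at hE
  refine Lim.of_mul ?_ hE (IsUnit.of_mul_eq_one _ hvi)
  rw [show u ^ 2 * vi * v = u ^ 2 by linear_combination u ^ 2 * hvi]
  have h1 := ((E_lim (R := K) (k := 1) (by omega)).comp (fun n => 2 * n) (fun n => by omega)).pow 2
  rw [← hu] at h1
  convert h1 using 2 with N
  simp only [JP, E_eq, prod_mul_range, ← prod_mul_distrib, ← prod_pow]
  apply prod_congr rfl; intro m _
  simp only [prod_range_succ, prod_range_zero]
  ring

lemma limW (hu : u = f K 1) (hv : v = f K 2) (hui : u * ui = 1) (hvi : v * vi = 1) :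
    Lim (JP (-1 : S3) 5 1) (v ^ 5 * ui ^ 2) := by
  have h1 := E_lim (R := K) (k := 1) (by omega)
  have h2 := E_lim (R := K) (k := 2) (by omega)
  have h3 := E_lim (R := K) (k := 3) (by omega)
  have h6 := E_lim (R := K) (k := 6) (by omega)
  have f3 := f_cube 1 (by omega)
  have f6 := f_cube 2 (by omega)
  norm_num at f3 f6
  rw [← f3] at h3
  rw [← f6] at h6
  rw [← hu] at h1 h3
  rw [← hv] at h2 h6
  have h23 := (h2.comp (fun n => 3 * n) (fun n => by omega)).mul (h3.comp (fun n => 2 * n) (fun n => by omega))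
  have h16 := (h1.comp (fun n => 6 * n) (fun n => by omega)).mul (h6.pow 2)
  refine Lim.of_mul ?_ h23 (IsUnit.of_mul_eq_one (vi * ui ^ 3) ?_)
  · rw [show v ^ 5 * ui ^ 2 * (v * u ^ 3) = u * (v ^ 3) ^ 2 * (u * ui) ^ 2 by ring, hui, one_pow, mul_one]
    convert h16 using 2 with N
    simp only [JP, E_eq, prod_mul_range, ← prod_mul_distrib, ← prod_pow]
    apply prod_congr rfl; intro m _
    simp only [prod_range_succ, prod_range_zero]
    ring
  · rw [show v * u ^ 3 * (vi * ui ^ 3) = (v * vi) * (u * ui) ^ 3 by ring, hui, hvi]; ring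

lemma limA (hu : u = f K 1) (hv : v = f K 2) (hui : u * ui = 1) (hvi : v * vi = 1) :
    Lim (JP (1 : S3) 2 1) (u ^ 5 * vi ^ 2) := by
  have h1 := E_lim (R := K) (k := 1) (by omega)
  have h2 := E_lim (R := K) (k := 2) (by omega)
  have h3 := E_lim (R := K) (k := 3) (by omega)
  have h6 := E_lim (R := K) (k := 6) (by omega)
  have f3 := f_cube 1 (by omega)
  have f6 := f_cube 2 (by omega)
  norm_num at f3 f6
  rw [← f3] at h3
  rw [← f6] at h6
  rw [← hu] at h1 h3
  rw [← hv] at h2 h6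
  have h16 := (h1.comp (fun n => 3 * n) (fun n => by omega)).mul h6
  have h23 := (h2.comp (fun n => 3 * n) (fun n => by omega)).mul (h3.pow 2)
  refine Lim.of_mul ?_ h16 (IsUnit.of_mul_eq_one (ui * vi ^ 3) ?_)
  · rw [show u ^ 5 * vi ^ 2 * (u * v ^ 3) = v * (u ^ 3) ^ 2 * (v * vi) ^ 2 by ring, hvi, one_pow, mul_one]
    convert h23 using 2 with N
    simp only [JP, E_eq, prod_mul_range, ← prod_mul_distrib, ← prod_pow]
    apply prod_congr rfl; intro m _
    simp only [prod_range_succ, prod_range_zero]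
    ring
  · rw [show u * v ^ 3 * (ui * vi ^ 3) = (v * vi) ^ 3 * (u * ui) by ring, hui, hvi]; ring

lemma E_D (N : ℕ) : E K 1 N * ∏ m ∈ range N, (1 + X ^ (m + 1)) = E K 2 N := by
  simp only [E_eq, ← prod_mul_distrib]
  apply prod_congr rfl; intro m _
  ring

lemma Lim.of_succ {s : ℕ → S3} {A : S3} (h : Lim (fun n => s (n + 1)) A) : Lim s A := by
  intro d
  obtain ⟨N, hN⟩ := h d
  refine ⟨N + 1, fun n hn => ?_⟩
  have := hN (n - 1) (by omega)
  simp only at this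
  rwa [show n - 1 + 1 = n by omega] at this

lemma limS (hu : u = f K 1) (hv : v = f K 2) (hui : u * ui = 1) :
    Lim (JP (1 : S3) 1 0) (2 * (v ^ 2 * ui)) := by
  apply Lim.of_succ
  have h1 := E_lim (R := K) (k := 1) (by omega)
  have h2 := E_lim (R := K) (k := 2) (by omega)
  rw [← hu] at h1
  rw [← hv] at h2
  have h := (Lim.const (2 : S3)).mul ((h2.comp (fun n => n + 1) (fun n => by omega)).mul h2)
  refine Lim.of_mul ?_ h1 (IsUnit.of_mul_eq_one _ hui)
  rw [show 2 * (v ^ 2 * ui) * u = 2 * (v * v) * (u * ui) by ring, hui, mul_one]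
  convert h using 2 with N
  rw [JP, prod_range_succ' (fun m => (1 + 1 * X ^ ((1 + 0) * m + 0) : S3)), ← E_D, ← E_D]
  simp only [one_mul, add_zero, pow_zero]
  ring

lemma th_P (m : ℕ) : th (-1 : S3) 2 1 1 (3 * m) + th (-1 : S3) 2 1 1 (3 * m + 1) + th (-1 : S3) 2 1 1 (3 * m + 2)
    = th (-1 : S3) 2 1 1 m ^ 9 + X * th (-1 : S3) 6 5 1 m ^ 3 := by
  have k (a b : S3) : (a + b) ^ 3 = a ^ 3 + b ^ 3 := add_pow_char a b 3
  have k9 (a b : S3) : (a + b) ^ 9 = a ^ 9 + b ^ 9 := by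
    rw [show (a + b) ^ 9 = ((a + b) ^ 3) ^ 3 by ring, k, k]; ring
  simp only [th]
  rw [k, k9]
  have t0 := tri_sq m
  have t1 := tri_sq (m + 1)
  have t2 := tri_sq (3 * m)
  have t3 := tri_sq (3 * m + 1)
  have t4 := tri_sq (3 * m + 2)
  have t5 := tri_sq (3 * m + 3)
  rw [show 2 * tri (3 * m) + 1 * (3 * m) = 9 * m ^ 2 by linarith,
    show 2 * tri (3 * m + 1) + 1 * (3 * m + 1) = 9 * m ^ 2 + 6 * m + 1 by linarith,
    show 3 * m + 1 + 1 = 3 * m + 2 by ring, show 3 * m + 2 + 1 = 3 * m + 3 by ring,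
    show 2 * tri (3 * m + 2) + 1 * (3 * m + 2) = 9 * m ^ 2 + 12 * m + 4 by linarith,
    show 2 * tri (3 * m + 3) + 1 * (3 * m + 3) = 9 * m ^ 2 + 18 * m + 9 by linarith,
    show 2 * tri m + 1 * m = m ^ 2 by linarith,
    show 2 * tri (m + 1) + 1 * (m + 1) = m ^ 2 + 2 * m + 1 by linarith,
    show 6 * tri m + 5 * m = 3 * m ^ 2 + 2 * m by linarith,
    show 6 * tri (m + 1) + 1 * (m + 1) = 3 * m ^ 2 + 4 * m + 1 by linarith]
  have s3 : ((-1 : S3) ^ m) ^ 2 = 1 := by rw [← pow_mul, mul_comm, pow_mul]; simp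
  have e0 : (-1 : S3) ^ (3 * m) = (-1) ^ m := by
    rw [show (-1 : S3) ^ (3 * m) = ((-1 : S3) ^ m) ^ 2 * (-1) ^ m by ring, s3, one_mul]
  have q3 : ((-1 : S3) ^ m) ^ 3 = (-1) ^ m := by rw [← pow_mul, mul_comm, e0]
  have q9 : ((-1 : S3) ^ m) ^ 9 = (-1) ^ m := by
    rw [show ((-1 : S3) ^ m) ^ 9 = (((-1 : S3) ^ m) ^ 3) ^ 3 by ring, q3, q3]
  simp only [pow_add (-1 : S3), mul_pow, e0, q3, q9]
  linear_combination ((-1) ^ m * X ^ (9 * m ^ 2 + 12 * m + 4) - (-1) ^ m * X ^ (9 * m ^ 2 + 6 * m + 1)) * three_eq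

lemma th_S (m : ℕ) : th (1 : S3) 1 1 0 (3 * m) + th (1 : S3) 1 1 0 (3 * m + 1) + th (1 : S3) 1 1 0 (3 * m + 2)
    = 2 * (th (1 : S3) 3 2 1 m ^ 3) + X * th (1 : S3) 1 1 0 m ^ 9 := by
  have k (a b : S3) : (a + b) ^ 3 = a ^ 3 + b ^ 3 := add_pow_char a b 3
  have k9 (a b : S3) : (a + b) ^ 9 = a ^ 9 + b ^ 9 := by
    rw [show (a + b) ^ 9 = ((a + b) ^ 3) ^ 3 by ring, k, k]; ring
  simp only [th]
  rw [k, k9]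
  have t0 := tri_sq m
  have t2 := tri_sq (3 * m)
  have e2 : tri (3 * m) = 9 * tri m + 3 * m := by linarith
  simp only [tri, e2]
  ring

lemma id_P {P W : S3} (hP : Lim (JP (-1 : S3) 1 1) P) (hW : Lim (JP (-1 : S3) 5 1) W) :
    P = P ^ 9 + X * W ^ 3 := by
  have tP := jtp (-1) (by ring) 1 1 (by omega) hP
  have tW := jtp (-1) (by ring) 5 1 (by omega) hW
  refine (tP.comp (fun n => 3 * n) (fun n => by omega)).unique ?_
  have := (tP.pow 9).add ((Lim.const X).mul (tW.pow 3))
  convert this using 2 with N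
  simp only [TH]
  rw [show ∀ a : S3, a ^ 9 = (a ^ 3) ^ 3 from fun a => by ring, sum_pow_char, sum_pow_char, sum_pow_char,
    mul_sum, ← sum_add_distrib, sum_mul_range]
  apply sum_congr rfl; intro m _
  simp only [sum_range_succ, sum_range_zero]
  have := th_P m
  norm_num at this ⊢
  rw [this]; ring

lemma id_S {S A : S3} (hS : Lim (JP (1 : S3) 1 0) (2 * S)) (hA : Lim (JP (1 : S3) 2 1) A) :
    S = A ^ 3 + X * S ^ 9 := by
  have tS := jtp 1 (by ring) 1 0 (by omega) hS
  have tA := jtp 1 (by ring) 2 1 (by omega) hA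
  have key : 2 * S = 2 * A ^ 3 + X * (2 * S) ^ 9 := by
    refine (tS.comp (fun n => 3 * n) (fun n => by omega)).unique ?_
    have := ((Lim.const 2).mul (tA.pow 3)).add ((Lim.const X).mul (tS.pow 9))
    convert this using 2 with N
    simp only [TH]
    rw [show ∀ a : S3, a ^ 9 = (a ^ 3) ^ 3 from fun a => by ring, sum_pow_char, sum_pow_char, sum_pow_char,
      mul_sum, mul_sum, ← sum_add_distrib, sum_mul_range]
    apply sum_congr rfl; intro m _
    simp only [sum_range_succ, sum_range_zero]
    have := th_S m
    norm_num at this ⊢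
    rw [this]; ring
  linear_combination 2 * key + (-S + A ^ 3 + 341 * X * S ^ 9) * three_eq

lemma final {F : S3} (hF : F * f K 1 ^ 14 = f K 2 ^ 13) (n : ℕ) :
    coeff (27 * n + 4) F = coeff (3 * n) F := by
  obtain ⟨ui, hui⟩ := (f_unit (R := K) (k := 1) (by omega)).exists_right_inv
  obtain ⟨vi, hvi⟩ := (f_unit (R := K) (k := 2) (by omega)).exists_right_inv
  have hP := id_P (limP rfl rfl hvi) (limW rfl rfl hui hvi)
  have hS := id_S (limS rfl rfl hui) (limA rfl rfl hui hvi)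
  generalize f K 1 = u at *
  generalize f K 2 = v at *
  have cu (a b c : ℕ) (h : a + b = c) : u ^ a * ui ^ c = ui ^ b := by
    rw [← h, pow_add, ← mul_assoc, ← mul_pow, hui]; simp
  have cu' (a b c : ℕ) (h : a + b = c) : u ^ c * ui ^ a = u ^ b := by
    rw [← h, pow_add, mul_right_comm, ← mul_pow, hui]; simp
  have cv (a b c : ℕ) (h : a + b = c) : v ^ a * vi ^ c = vi ^ b := by
    rw [← h, pow_add, ← mul_assoc, ← mul_pow, hvi]; simp
  have cv' (a b c : ℕ) (h : a + b = c) : v ^ c * vi ^ a = v ^ b := by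
    rw [← h, pow_add, mul_right_comm, ← mul_pow, hvi]; simp
  set P := u ^ 2 * vi with hPd
  set S := v ^ 2 * ui with hSd
  set W := v ^ 5 * ui ^ 2 with hWd
  set A := u ^ 5 * vi ^ 2 with hAd
  have F1 : F = (v ^ 5 * ui ^ 6) ^ 3 * P ^ 2 := by
    calc F = F * u ^ 14 * ui ^ 14 := by rw [mul_assoc, cu' 14 0 14 rfl]; ring
      _ = v ^ 13 * ui ^ 14 := by rw [hF]
      _ = (v ^ 15 * vi ^ 2) * (u ^ 4 * ui ^ 18) := by rw [cu 4 14 18 rfl, cv' 2 13 15 rfl]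
      _ = _ := by rw [hPd]; ring
  have F2 : F = (u ^ 6 * vi) ^ 3 + X * (-S ^ 3 * (u * v)) ^ 3 + X ^ 2 * (v ^ 5 * ui ^ 6 * W ^ 2) ^ 3 := by
    have a0 : u ^ 6 * vi = v ^ 5 * ui ^ 6 * P ^ 6 := by
      calc _ = (u ^ 12 * ui ^ 6) * (v ^ 5 * vi ^ 6) := by rw [cu' 6 6 12 rfl, cv 5 1 6 rfl]; ring
        _ = _ := by rw [hPd]; ring
    have a1 : -S ^ 3 * (u * v) = 2 * (v ^ 5 * ui ^ 6 * P ^ 3 * W) := by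
      calc _ = - (u ^ 1 * ui ^ 3) * v ^ 7 := by rw [hSd]; ring
        _ = 2 * ((u ^ 6 * ui ^ 8) * (v ^ 10 * vi ^ 3)) := by
          rw [cu 1 2 3 rfl, cu 6 2 8 rfl, cv' 3 7 10 rfl]
          linear_combination (- ui ^ 2 * v ^ 7) * three_eq
        _ = _ := by rw [hPd, hWd]; ring
    rw [a0, a1, F1]
    conv_lhs => rw [hP]
    linear_combination (-2 * X * (v ^ 5 * ui ^ 6 * P ^ 3 * W) ^ 3) * three_eq
  have PS : u * v = P * S := by
    calc u * v = (u ^ 2 * ui ^ 1) * (v ^ 2 * vi ^ 1) := by rw [cu' 1 1 2 rfl, cv' 1 1 2 rfl]; ring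
      _ = _ := by rw [hPd, hSd]; ring
  have WA : W * A = (u * v) ^ 3 := by
    calc _ = (u ^ 5 * ui ^ 2) * (v ^ 5 * vi ^ 2) := by rw [hWd, hAd]; ring
      _ = _ := by rw [cu' 2 3 5 rfl, cv' 2 3 5 rfl]; ring
  have F3 : -S ^ 3 * (u * v) = (-S * (P ^ 3 * A)) ^ 3 + X * ((u * v) ^ 3 * S) ^ 3
      + X ^ 2 * (-S * (W * S ^ 3)) ^ 3 := by
    have : (u * v) ^ 3 * S = -S * ((P * S) ^ 3 + W * A) := by
      rw [WA, ← PS]; linear_combination ((u * v) ^ 3 * S) * three_eq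
    rw [this, PS]
    have k (a b : S3) : (a + b) ^ 3 = a ^ 3 + b ^ 3 := add_pow_char a b 3
    rw [mul_pow (-S) ((P * S) ^ 3 + W * A), k]
    calc -S ^ 3 * (P * S) = -S ^ 3 * ((P ^ 9 + X * W ^ 3) * (A ^ 3 + X * S ^ 9)) := by rw [← hP, ← hS]
      _ = _ := by ring
  have F4 : (u * v) ^ 3 * S = (u * v * A) ^ 3 + X * (u * v * S ^ 3) ^ 3 + X ^ 2 * (0 : S3) ^ 3 := by
    calc (u * v) ^ 3 * S = (u * v) ^ 3 * (A ^ 3 + X * S ^ 9) := by rw [← hS]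
      _ = _ := by ring
  have F5 : u * v * A = u ^ 6 * vi := by
    calc u * v * A = u ^ 6 * (v ^ 1 * vi ^ 2) := by rw [hAd]; ring
      _ = _ := by rw [cv 1 1 2 rfl]; ring
  have r : coeff (3 * n) F = coeff n (u ^ 6 * vi) := by rw [F2, dis0]
  rw [r, show 27 * n + 4 = 3 * (3 * (3 * n) + 1) + 1 by ring, F2, dis1, F3, dis1, F4, dis0, F5]

/-- multisets supported on `T` of weight `n` -/
def ms (T : Finset (ℕ × ℕ)) (n : ℕ) : Set (Multiset (ℕ × ℕ)) :=
  {s | (∀ p ∈ s, p ∈ T) ∧ (s.map Prod.fst).sum = n}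

lemma card_le_sum (s : Multiset (ℕ × ℕ)) (h : ∀ p ∈ s, 0 < p.1) :
    s.card ≤ (s.map Prod.fst).sum := by
  induction s using Multiset.induction with
  | empty => simp
  | cons p s ih =>
    have h1 := h p (by simp)
    have h2 := ih (fun q hq => h q (by simp [hq]))
    simp; omega

lemma ms_finite (T : Finset (ℕ × ℕ)) (hT : ∀ p ∈ T, 0 < p.1) (n : ℕ) : (ms T n).Finite := by
  apply (Multiset.finite_toSet (Multiset.powerset (n • T.val))).subset
  rintro s ⟨h1, h2⟩
  simp only [Set.mem_ofPred_eq, Multiset.mem_powerset]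
  rw [Multiset.le_iff_count]
  intro p
  by_cases hp : p ∈ s
  · rw [Multiset.count_nsmul, Multiset.count_eq_one_of_mem T.nodup (h1 p hp), mul_one]
    have := card_le_sum s (fun q hq => hT q (h1 q hq))
    have := Multiset.count_le_card p s
    omega
  · simp [hp]

lemma ms_rec (T : Finset (ℕ × ℕ)) (p : ℕ × ℕ) (hp : p ∉ T) (hT : ∀ q ∈ insert p T, 0 < q.1) (n : ℕ) :
    (ms (insert p T) n).ncard = (ms T n).ncard +
      if p.1 ≤ n then (ms (insert p T) (n - p.1)).ncard else 0 := by
  have key : ms (insert p T) n = ms T n ∪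
      (fun s => p ::ₘ s) '' (if p.1 ≤ n then ms (insert p T) (n - p.1) else ∅) := by
    ext s
    constructor
    · rintro ⟨h1, h2⟩
      by_cases hs : p ∈ s
      · right
        obtain ⟨t, rfl⟩ := Multiset.exists_cons_of_mem hs
        simp only [Multiset.map_cons, Multiset.sum_cons] at h2
        rw [if_pos (by omega)]
        exact ⟨t, ⟨fun q hq => h1 q (by simp [hq]), by omega⟩, rfl⟩
      · left
        refine ⟨fun q hq => ?_, h2⟩
        rcases Finset.mem_insert.1 (h1 q hq) with rfl | h
        · exact absurd hq hs
        · exact h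
    · rintro (⟨h1, h2⟩ | ⟨t, ht, rfl⟩)
      · exact ⟨fun q hq => Finset.mem_insert_of_mem (h1 q hq), h2⟩
      · split_ifs at ht with hn
        · refine ⟨fun q hq => ?_, ?_⟩
          · rcases Multiset.mem_cons.1 hq with rfl | h
            · simp
            · exact ht.1 q h
          · have := ht.2
            simp only [Multiset.map_cons, Multiset.sum_cons]; omega
        · exact absurd ht (by simp)
  have fin2 : (if p.1 ≤ n then ms (insert p T) (n - p.1) else ∅).Finite := by
    split_ifs
    · exact ms_finite _ hT _
    · exact Set.finite_empty
  rw [key, Set.ncard_union_eq _ (ms_finite _ (fun q hq => hT q (by simp [hq])) _) (fin2.image _),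
    Set.ncard_image_of_injective _ (fun s t h => by simpa using h)]
  · split_ifs <;> simp
  · rw [Set.disjoint_left]
    rintro s ⟨h1, _⟩ ⟨t, _, rfl⟩
    exact hp (h1 p (by simp))

/-- generating function of `ms T` -/
noncomputable def gen (T : Finset (ℕ × ℕ)) : S3 := PowerSeries.mk fun n => ((ms T n).ncard : ZMod 3)

lemma gen_prod (T : Finset (ℕ × ℕ)) (hT : ∀ p ∈ T, 0 < p.1) :
    gen T * ∏ p ∈ T, (1 - X ^ p.1) = 1 := by
  induction T using Finset.induction_on with
  | empty =>
    rw [prod_empty, mul_one]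
    ext n
    rw [gen, coeff_mk, coeff_one]
    have : ms ∅ n = if n = 0 then {0} else ∅ := by
      ext s
      simp only [ms, Finset.notMem_empty, Set.mem_ofPred_eq]
      constructor
      · rintro ⟨h1, h2⟩
        have : s = 0 := Multiset.eq_zero_of_forall_notMem h1
        subst this
        simp at h2; simp [← h2]
      · split_ifs with h
        · rintro rfl; simp [h]
        · simp
    rw [this]; split_ifs <;> simp
  | insert p T hp ih =>
    rw [prod_insert hp, ← mul_assoc]
    have : gen (insert p T) * (1 - X ^ p.1) = gen T := by
      rw [mul_sub, mul_one, sub_eq_iff_eq_add]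
      ext n
      rw [map_add, coeff_mul_X_pow']
      simp only [gen, coeff_mk]
      rw [ms_rec T p hp hT]
      split_ifs <;> simp
    rw [this, ih (fun q hq => hT q (by simp [hq]))]

/-- allowed parts up to `2N` -/
def parts (k N : ℕ) : Finset (ℕ × ℕ) :=
  ((range N) ×ˢ (range k)).image (fun p => (2 * p.1 + 1, p.2 + 1)) ∪
    (range N).image (fun m => (2 * m + 2, 1))

lemma parts_prod (k N : ℕ) : ∏ p ∈ parts k N, (1 - X ^ p.1 : S3) =
    (∏ m ∈ range N, (1 - X ^ (2 * m + 1))) ^ k * ∏ m ∈ range N, (1 - X ^ (2 * m + 2)) := by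
  rw [parts, prod_union, prod_image, prod_image, prod_product]
  · simp [prod_pow]
  · intro x _ y _ h; simp at h; exact h
  · rintro ⟨x, x'⟩ _ ⟨y, y'⟩ _ h; simp at h; simp; omega
  · rw [Finset.disjoint_left]
    intro p hp hq
    simp only [mem_image] at hp hq
    obtain ⟨x, _, rfl⟩ := hp
    obtain ⟨y, _, h⟩ := hq
    simp at h; omega

lemma mem_parts (k N : ℕ) (hk : 1 ≤ k) (p : ℕ × ℕ) : p ∈ parts k N ↔
    (0 < p.1 ∧ 1 ≤ p.2 ∧ p.2 ≤ k ∧ (Even p.1 → p.2 = 1)) ∧ p.1 ≤ 2 * N := by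
  obtain ⟨m, c⟩ := p
  simp only [parts, mem_union, mem_image, mem_product, mem_range, Prod.exists, Prod.mk.injEq,
    Nat.even_iff]
  constructor
  · rintro (⟨x, y, h, rfl, rfl⟩ | ⟨x, h, rfl, rfl⟩) <;> omega
  · rintro ⟨⟨h1, h2, h3, h4⟩, h5⟩
    rcases Nat.even_or_odd' m with ⟨x, rfl | rfl⟩
    · right; exact ⟨x - 1, by omega, by omega, by omega⟩
    · left; exact ⟨x, c - 1, by omega, by omega, by omega⟩

lemma a_eq (k N n : ℕ) (hk : 1 ≤ k) (hn : n ≤ 2 * N) : a k n = (ms (parts k N) n).ncard := by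
  rw [a, Nat.card_coe_set_eq]
  congr 1
  ext s
  simp only [coloredOddPartitions, ms, Set.mem_ofPred_eq, mem_parts k N hk]
  constructor
  · rintro ⟨h1, h2⟩
    refine ⟨fun p hp => ⟨h1 p hp, ?_⟩, h2⟩
    have := Multiset.le_sum_of_mem (Multiset.mem_map_of_mem Prod.fst hp)
    omega
  · rintro ⟨h1, h2⟩
    exact ⟨fun p hp => (h1 p hp).1, h2⟩

lemma main_gen : (PowerSeries.mk fun n => (a 14 n : ZMod 3)) * f K 1 ^ 14 = f K 2 ^ 13 := by
  have hF : Lim (fun N => gen (parts 14 N)) (PowerSeries.mk fun n => (a 14 n : ZMod 3)) := by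
    intro d
    refine ⟨d, fun N hN => X_pow_dvd_iff.2 fun m hm => ?_⟩
    simp only [map_sub, gen, coeff_mk]
    rw [a_eq 14 N m (by omega) (by omega), sub_self]
  have h1 := ((E_lim (R := K) (k := 1) (by omega)).comp (fun n => 2 * n) (fun n => by omega)).pow 14
  have h2 := (E_lim (R := K) (k := 2) (by omega)).pow 13
  refine Lim.unique (hF.mul h1) ?_
  convert h2 using 2 with N
  have hg := gen_prod (parts 14 N) (fun p hp => ((mem_parts 14 N (by omega) p).1 hp).1.1)
  rw [parts_prod] at hg
  have e1 : E K 1 (2 * N) = (∏ m ∈ range N, (1 - X ^ (2 * m + 1))) * ∏ m ∈ range N, (1 - X ^ (2 * m + 2)) := by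
    rw [E_eq, prod_mul_range, ← prod_mul_distrib]
    apply prod_congr rfl; intro m _
    simp only [prod_range_succ, prod_range_zero]
    ring
  rw [e1, E_eq 2 N]
  linear_combination (∏ m ∈ range N, (1 - X ^ (2 * m + 2))) ^ 13 * hg

end Stmt18

theorem stmt18 (n : ℕ) : a 14 (27 * n + 4) ≡ a 14 (3 * n) [MOD 3] := by
  rw [← ZMod.natCast_eq_natCast_iff]
  simpa using Stmt18.final Stmt18.main_gen n
end

section
/- For all integers n ≥ 0, a_{23}(27n + 16) ≡ a_{23}(3n + 1) (mod 3). -/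
namespace Stmt19
open Finset

section Shanks
variable {R : Type*} [CommRing R]

theorem shanks_psi (x : R) (v : ℕ → R) (hv : ∀ k, v k * (1 - x ^ (2 * k + 1)) = 1) (n : ℕ) :
    ∑ s ∈ range n, (∏ k ∈ Ico s n, ((1 - x ^ (2 * k + 2)) * v k)) * x ^ (s * (2 * n + 1))
      = ∑ s ∈ range (2 * n), x ^ (s * (s + 1) / 2) := by
  induction n with
  | zero => simp
  | succ n ih =>
    set p : ℕ → ℕ → R := fun n s => ∏ k ∈ Ico s n, ((1 - x ^ (2 * k + 2)) * v k) with hp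
    have hp1 : ∀ s, s ≤ n → p (n + 1) s = p n s * ((1 - x ^ (2 * n + 2)) * v n) := fun s hs => by
      simp only [hp]; rw [Finset.prod_Ico_succ_top hs]
    have hp2 : ∀ s, s < n → p n s = (1 - x ^ (2 * s + 2)) * v s * p n (s + 1) := fun s hs => by
      simp only [hp]; rw [Finset.prod_eq_prod_Ico_succ_bot hs]
    have hp3 : p n n = 1 := by simp [hp]
    have key : ∀ j, j ≤ n → ∑ s ∈ range j, (p (n + 1) s * x ^ (s * (2 * (n + 1) + 1))
        - p n s * x ^ (s * (2 * n + 1)))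
        = p n j * x ^ (j * (2 * n + 1)) * (1 - x ^ (2 * j)) * v n := by
      intro j
      induction j with
      | zero => simp
      | succ j ihj =>
        intro hj
        rw [sum_range_succ, ihj (by omega), hp1 j (by omega), hp2 j (by omega)]
        have e1 : x ^ (j * (2 * (n + 1) + 1)) = x ^ (j * (2 * n + 1)) * x ^ (2 * j) := by ring
        have e2 : x ^ ((j + 1) * (2 * n + 1)) = x ^ (j * (2 * n + 1)) * x ^ (2 * n + 1) := by ring
        have e3 : x ^ (2 * (j + 1)) = x ^ (2 * j) * x ^ 2 := by ring
        have e4 : x ^ (2 * j + 2) = x ^ (2 * j) * x ^ 2 := by ring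
        have e5 : x ^ (2 * n + 2) = x ^ (2 * n + 1) * x := by ring
        rw [e1, e2, e3, e4, e5]
        have h1 := hv n
        have h2 := hv j
        rw [show x ^ (2 * j + 1) = x ^ (2 * j) * x by ring] at h2
        generalize x ^ (2 * j) = a at *
        generalize x ^ (2 * n + 1) = b at *
        generalize x ^ (j * (2 * n + 1)) = c at *
        generalize p n (j + 1) = d at *
        generalize v n = e at *
        generalize v j = f at *
        linear_combination d * c * (1 - a * x ^ 2) * (f * h1 + b * e * h2)
    have e := key n le_rfl
    rw [sum_sub_distrib, ih, hp3] at e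
    change ∑ s ∈ range (n + 1), p (n + 1) s * x ^ (s * (2 * (n + 1) + 1)) = _
    rw [sum_range_succ, hp1 n le_rfl, hp3, sub_eq_iff_eq_add.mp e,
      show 2 * (n + 1) = 2 * n + 1 + 1 by ring, sum_range_succ, sum_range_succ]
    have t1 : 2 * n * (2 * n + 1) / 2 = n * (2 * n + 1) := by
      rw [mul_assoc]; exact Nat.mul_div_cancel_left _ (by norm_num)
    have t2 : (2 * n + 1) * (2 * n + 1 + 1) / 2 = (n + 1) * (2 * n + 1) := by
      rw [show (2 * n + 1) * (2 * n + 1 + 1) = 2 * ((n + 1) * (2 * n + 1)) by ring]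
      exact Nat.mul_div_cancel_left _ (by norm_num)
    rw [t1, t2]
    have h1 := hv n
    linear_combination (x ^ (n * (2 * n + 1)) * (1 + x ^ (2 * n + 1))) * h1

theorem psi_dvd (x : R) (v : ℕ → R) (hv : ∀ k, v k * (1 - x ^ (2 * k + 1)) = 1) (n : ℕ)
    (hn : 0 < n) :
    x ^ (2 * n + 1) ∣ (∏ k ∈ range n, (1 - x ^ (2 * k + 1))) *
      (∑ s ∈ range (2 * n), x ^ (s * (s + 1) / 2)) - ∏ k ∈ range n, (1 - x ^ (2 * k + 2)) := by
  rw [← shanks_psi x v hv n]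
  obtain ⟨m, rfl⟩ : ∃ m, n = m + 1 := ⟨n - 1, by omega⟩
  rw [sum_range_succ', mul_add (∏ k ∈ range (m+1), (1 - x ^ (2 * k + 1)))]
  have : (∏ k ∈ range (m+1), (1 - x ^ (2 * k + 1))) *
    ((∏ k ∈ Ico 0 (m+1), ((1 - x ^ (2 * k + 2)) * v k)) * x ^ (0 * (2 * (m+1) + 1)))
      = ∏ k ∈ range (m+1), (1 - x ^ (2 * k + 2)) := by
    rw [zero_mul, pow_zero, mul_one, ← range_eq_Ico, ← prod_mul_distrib]
    refine prod_congr rfl fun k _ => ?_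
    linear_combination (1 - x ^ (2 * k + 2)) * hv k
  rw [this, add_sub_cancel_right]
  refine Dvd.dvd.mul_left (dvd_sum fun s _ => Dvd.dvd.mul_left (pow_dvd_pow _ ?_) _) _
  nlinarith

theorem shanks_phi (x : R) (v w : ℕ → R) (hv : ∀ k, v k * (1 - x ^ (k + 1)) = 1)
    (hw : ∀ k, w k * (1 + x ^ (k + 1)) = 1) (n : ℕ) :
    ∑ s ∈ range (n + 1), (-1) ^ s * (∏ k ∈ range n, ((1 - x ^ (k + 1)) * w k)) *
      (∏ k ∈ range s, ((1 + x ^ k) * v k)) * x ^ (s * (n + 1))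
      = 1 + 2 * ∑ s ∈ range n, (-1) ^ (s + 1) * x ^ ((s + 1) ^ 2) := by
  set q : ℕ → R := fun n => ∏ k ∈ range n, ((1 - x ^ (k + 1)) * w k) with hq
  set r : ℕ → R := fun s => ∏ k ∈ range s, ((1 + x ^ k) * v k) with hr
  have hq1 : ∀ n, q (n + 1) = q n * ((1 - x ^ (n + 1)) * w n) := fun n => by
    simp only [hq]; rw [prod_range_succ]
  have hr1 : ∀ n, r (n + 1) = r n * ((1 + x ^ n) * v n) := fun n => by
    simp only [hr]; rw [prod_range_succ]
  have hqr : ∀ n, r n * q n * (1 + x ^ n) = 2 := by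
    intro n
    induction n with
    | zero => simp [hq, hr]; norm_num
    | succ n ih =>
      rw [hq1, hr1]
      have h1 := hv n
      have h2 := hw n
      linear_combination ih + r n * q n * (1 + x ^ n) * h1 * w n * (1 + x ^ (n + 1))
        + r n * q n * (1 + x ^ n) * h2
  induction n with
  | zero => simp [hq, hr]
  | succ n ih =>
    have key : ∀ j, ∑ s ∈ range j, ((-1) ^ s * q (n + 1) * r s * x ^ (s * (n + 1 + 1))
        - (-1) ^ s * q n * r s * x ^ (s * (n + 1)))
        = (-1) ^ j * q n * r j * x ^ (j * (n + 1)) * (1 - x ^ j) * w n := by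
      intro j
      induction j with
      | zero => simp
      | succ j ihj =>
        rw [sum_range_succ, ihj, hq1, hr1]
        have e1 : x ^ (j * (n + 1 + 1)) = x ^ (j * (n + 1)) * x ^ j := by ring
        have e2 : x ^ ((j + 1) * (n + 1)) = x ^ (j * (n + 1)) * x ^ (n + 1) := by ring
        rw [e1, e2]
        have h1 := hw n
        have h2 := hv j
        rw [pow_succ (-1 : R)]
        generalize x ^ (j + 1) = a' at *
        generalize x ^ j = a at *
        generalize x ^ (n + 1) = b at *
        generalize x ^ (j * (n + 1)) = c at *
        generalize w n = e at *
        generalize v j = f at *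
        generalize (-1 : R) ^ j = g at *
        generalize q n = d at *
        generalize r j = k at *
        linear_combination g * d * k * c * (h1 + b * e * (1 + a) * h2)
    have e := key (n + 1)
    rw [sum_sub_distrib, ih] at e
    change ∑ s ∈ range (n + 1 + 1), (-1) ^ s * q (n + 1) * r s * x ^ (s * (n + 1 + 1)) = _
    rw [sum_range_succ, sub_eq_iff_eq_add.mp e, sum_range_succ _ n]
    have h1 := hqr (n + 1)
    rw [hq1] at h1 ⊢
    have h2 := hw n
    have e3 : x ^ ((n + 1) * (n + 1 + 1)) = x ^ ((n + 1) * (n + 1)) * x ^ (n + 1) := by ring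
    have e4 : x ^ ((n + 1) ^ 2) = x ^ ((n + 1) * (n + 1)) := by ring
    rw [e3, e4]
    linear_combination (-1) ^ (n + 1) * x ^ ((n + 1) * (n + 1)) * h1

theorem phi_dvd (x : R) (v w : ℕ → R) (hv : ∀ k, v k * (1 - x ^ (k + 1)) = 1)
    (hw : ∀ k, w k * (1 + x ^ (k + 1)) = 1) (n : ℕ) :
    x ^ (n + 1) ∣ (∏ k ∈ range n, (1 + x ^ (k + 1))) *
      (1 + 2 * ∑ s ∈ range n, (-1) ^ (s + 1) * x ^ ((s + 1) ^ 2))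
      - ∏ k ∈ range n, (1 - x ^ (k + 1)) := by
  rw [← shanks_phi x v w hv hw n, sum_range_succ', mul_add]
  have : (∏ k ∈ range n, (1 + x ^ (k + 1))) *
    ((-1) ^ 0 * (∏ k ∈ range n, ((1 - x ^ (k + 1)) * w k)) *
      (∏ k ∈ range 0, ((1 + x ^ k) * v k)) * x ^ (0 * (n + 1)))
      = ∏ k ∈ range n, (1 - x ^ (k + 1)) := by
    rw [zero_mul, pow_zero, pow_zero, mul_one, one_mul, prod_range_zero, mul_one,
      ← prod_mul_distrib]
    refine prod_congr rfl fun k _ => ?_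
    linear_combination (1 - x ^ (k + 1)) * hw k
  rw [this, add_sub_cancel_right]
  refine Dvd.dvd.mul_left (dvd_sum fun s _ => Dvd.dvd.mul_left (pow_dvd_pow _ ?_) _) _
  nlinarith
end Shanks

/-- Coefficients of `φ(-q)`. -/
noncomputable def phiC (n : ℕ) : ZMod 3 :=
  ∑ x ∈ Icc (-(n : ℤ)) n, if x ^ 2 = (n : ℤ) then (-1) ^ x.natAbs else 0

/-- Coefficients of `ψ(q)`. -/
noncomputable def psiC (n : ℕ) : ZMod 3 :=
  ∑ t ∈ range (n + 1), if t * (t + 1) / 2 = n then 1 else 0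

noncomputable def Phi : PowerSeries (ZMod 3) := PowerSeries.mk phiC
noncomputable def Psi : PowerSeries (ZMod 3) := PowerSeries.mk psiC

theorem phiC_box (n M : ℕ) (h : n ≤ M) :
    phiC n = ∑ x ∈ Icc (-(M : ℤ)) M, if x ^ 2 = (n : ℤ) then (-1) ^ x.natAbs else 0 := by
  unfold phiC
  apply sum_subset
  · intro x; simp only [mem_Icc]; omega
  · intro x _ hx
    rw [if_neg]
    intro h2
    apply hx
    rw [mem_Icc]
    constructor <;> nlinarith [sq_nonneg (x - 1), sq_nonneg (x + 1), sq_nonneg x,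
      Int.le_self_sq x, Int.le_self_sq (-x)]

theorem psiC_box (n M : ℕ) (h : n < M) :
    psiC n = ∑ t ∈ range M, if t * (t + 1) / 2 = n then 1 else 0 := by
  unfold psiC
  apply sum_subset
  · intro x; simp only [mem_range]; omega
  · intro x _ hx
    rw [if_neg]
    intro h2
    apply hx
    rw [mem_range]
    by_contra h3
    have : x * 2 ≤ x * (x + 1) := Nat.mul_le_mul_left _ (by omega)
    omega

theorem sum_Icc_symm {M : Type*} [AddCommMonoid M] (f : ℤ → M) (n : ℕ) :
    ∑ x ∈ Icc (-(n : ℤ)) n, f x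
      = f 0 + ∑ s ∈ range n, (f ((s : ℤ) + 1) + f (-((s : ℤ) + 1))) := by
  induction n with
  | zero => simp
  | succ n ih =>
    rw [sum_range_succ, ← add_assoc, ← ih]
    have : Icc (-((n + 1 : ℕ) : ℤ)) ((n + 1 : ℕ) : ℤ)
        = insert ((n : ℤ) + 1) (insert (-((n : ℤ) + 1)) (Icc (-(n : ℤ)) n)) := by
      ext x; simp only [mem_insert, mem_Icc]; push_cast; omega
    rw [this, sum_insert, sum_insert]
    · rw [← add_assoc, add_comm]
    · simp
    · simp only [mem_insert, mem_Icc]; omega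

open PowerSeries in
theorem Psi_approx (n : ℕ) :
    (X : PowerSeries (ZMod 3)) ^ n ∣ Psi - ∑ s ∈ range (2 * n), X ^ (s * (s + 1) / 2) := by
  rw [X_pow_dvd_iff]
  intro m hm
  simp only [map_sub, map_sum, Psi, coeff_mk, coeff_X_pow]
  rw [psiC_box m (2 * n) (by omega), sub_eq_zero]
  exact sum_congr rfl fun t _ => by simp only [eq_comm]

open PowerSeries in
theorem Phi_approx (n : ℕ) :
    (X : PowerSeries (ZMod 3)) ^ n ∣ Phi -
      (1 + 2 * ∑ s ∈ range (2 * n), (-1) ^ (s + 1) * X ^ ((s + 1) ^ 2)) := by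
  rw [X_pow_dvd_iff]
  intro m hm
  have h2 : (2 : PowerSeries (ZMod 3)) = C 2 := (map_ofNat C 2).symm
  have h1 : ∀ s : ℕ, (-1 : PowerSeries (ZMod 3)) ^ s = C ((-1) ^ s) := by simp
  simp only [h1, h2, map_sub, map_add, map_sum, Phi, coeff_mk, coeff_C_mul, coeff_X_pow, coeff_one]
  rw [phiC_box m (2 * n) (by omega), sub_eq_zero, sum_Icc_symm, mul_sum]
  congr 1
  · simp [eq_comm]
  · refine sum_congr rfl fun s _ => ?_
    have e1 : ((s : ℤ) + 1) ^ 2 = m ↔ m = (s + 1) ^ 2 := by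
      rw [eq_comm]; exact_mod_cast Iff.rfl
    have e2 : (-((s : ℤ) + 1)) ^ 2 = m ↔ m = (s + 1) ^ 2 := by rw [neg_sq, e1]
    have e3 : ((s : ℤ) + 1).natAbs = s + 1 := by omega
    simp only [e1, e2, Int.natAbs_neg, e3]
    split_ifs <;> ring

theorem ring_lemma {Q : Type*} [CommRing Q] (A D E ps ph M : Q) (h1 : A * (D * E ^ 23) = 1)
    (h2 : E * ps = D) (h3 : M * ph = D * E) (h4 : M * (D * E) = D) : A * ph ^ 8 = ps ^ 7 := by
  have hE : IsUnit E := IsUnit.of_mul_eq_one (A * D * E ^ 22) (by rw [← h1]; ring)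
  have hD : IsUnit D := IsUnit.of_mul_eq_one (A * E ^ 23) (by rw [← h1]; ring)
  have hM : M * E = 1 := hD.mul_left_cancel (by rw [mul_one]; linear_combination h4)
  have hph : ph = D * E ^ 2 := by
    linear_combination E * h3 - ph * hM
  apply (hE.pow 7).mul_left_cancel
  rw [← mul_pow, h2, hph]
  linear_combination D ^ 7 * h1

theorem prod_range_two_mul {M : Type*} [CommMonoid M] (f : ℕ → M) (n : ℕ) :
    ∏ k ∈ range (2 * n), f k = (∏ k ∈ range n, f (2 * k + 1)) * ∏ k ∈ range n, f (2 * k) := by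
  induction n with
  | zero => simp
  | succ n ih =>
    rw [show 2 * (n + 1) = 2 * n + 1 + 1 by ring, prod_range_succ, prod_range_succ, ih,
      prod_range_succ, prod_range_succ]
    simp only [mul_assoc, mul_comm, mul_left_comm]

open PowerSeries in
theorem main_product (A : PowerSeries (ZMod 3))
    (hA : ∀ N, X ^ N ∣ A * ((∏ k ∈ range N, (1 - X ^ (2 * k + 2))) *
      (∏ k ∈ range N, (1 - X ^ (2 * k + 1))) ^ 23) - 1) : A * Phi ^ 8 = Psi ^ 7 := by
  suffices h : ∀ N, 0 < N → (X : PowerSeries (ZMod 3)) ^ N ∣ A * Phi ^ 8 - Psi ^ 7 by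
    ext n
    have := (X_pow_dvd_iff.mp (h (n + 1) (by omega))) n (by omega)
    rwa [map_sub, sub_eq_zero] at this
  intro N hN
  have hv : ∀ k, (1 - X ^ (k + 1) : PowerSeries (ZMod 3))⁻¹ * (1 - X ^ (k + 1)) = 1 := fun k =>
    PowerSeries.inv_mul_cancel _ (by simp)
  have hw : ∀ k, (1 + X ^ (k + 1) : PowerSeries (ZMod 3))⁻¹ * (1 + X ^ (k + 1)) = 1 := fun k =>
    PowerSeries.inv_mul_cancel _ (by simp)
  have d1 := psi_dvd (X : PowerSeries (ZMod 3)) (fun k => (1 - X ^ (2 * k + 1))⁻¹)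
    (fun k => hv (2 * k)) N hN
  have d2 := phi_dvd (X : PowerSeries (ZMod 3)) (fun k => (1 - X ^ (k + 1))⁻¹)
    (fun k => (1 + X ^ (k + 1))⁻¹) hv hw (2 * N)
  have d3 := Psi_approx N
  have d4 := Phi_approx N
  have d5 := hA N
  replace d1 := (pow_dvd_pow (X : PowerSeries (ZMod 3)) (show N ≤ 2 * N + 1 by omega)).trans d1
  replace d2 := (pow_dvd_pow (X : PowerSeries (ZMod 3)) (show N ≤ 2 * N + 1 by omega)).trans d2
  set I := Ideal.span {(X : PowerSeries (ZMod 3)) ^ N} with hI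
  have hq : ∀ a b : PowerSeries (ZMod 3), X ^ N ∣ a - b ↔
      Ideal.Quotient.mk I a = Ideal.Quotient.mk I b := fun a b => by
    rw [Ideal.Quotient.eq, hI, Ideal.mem_span_singleton]
  rw [hq] at d1 d2 d3 d4 d5 ⊢
  rw [map_mul, ← d3] at d1
  rw [map_mul, ← d4, prod_range_two_mul (fun k => (1 - X ^ (k + 1) : PowerSeries (ZMod 3))),
    map_mul] at d2
  rw [map_mul, map_mul, map_pow, map_one] at d5
  rw [map_mul, map_pow, map_pow]
  refine ring_lemma _ _ _ _ _ _ d5 d1 d2 ?_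
  rw [← map_mul, ← map_mul, ← hq]
  have e := prod_range_two_mul (fun k => (1 - X ^ (k + 1) : PowerSeries (ZMod 3))) N
  simp only [add_assoc, Nat.reduceAdd] at e
  rw [← e, ← prod_mul_distrib, hq, two_mul, prod_range_add, map_mul]
  have e1 : ∀ k : ℕ, ((1 + X ^ (k + 1)) * (1 - X ^ (k + 1)) : PowerSeries (ZMod 3))
      = 1 - X ^ (2 * k + 2) := fun k => by ring
  simp only [e1]
  rw [map_prod _ _ (range N), map_prod _ _ (range N)]
  nth_rewrite 2 [prod_eq_one]
  · rw [mul_one]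
  · intro k _
    rw [← map_one (Ideal.Quotient.mk I), ← hq]
    rw [show (1 : PowerSeries (ZMod 3)) - X ^ (2 * (N + k) + 2) - 1 = -X ^ (2 * (N + k) + 2) by ring]
    exact (pow_dvd_pow _ (by omega)).neg_right
theorem sum_range_two_mul {M : Type*} [AddCommMonoid M] (f : ℕ → M) (n : ℕ) :
    ∑ k ∈ range (2 * n), f k = (∑ k ∈ range n, f (2 * k + 1)) + ∑ k ∈ range n, f (2 * k) := by
  induction n with
  | zero => simp
  | succ n ih =>
    rw [show 2 * (n + 1) = 2 * n + 1 + 1 by ring, sum_range_succ, sum_range_succ, ih,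
      sum_range_succ, sum_range_succ]
    abel

open Classical in
theorem psiC_eq (n : ℕ) : psiC n = if ∃ t, t * (t + 1) = 2 * n then 1 else 0 := by
  have key : ∀ t : ℕ, t * (t + 1) / 2 = n ↔ t * (t + 1) = 2 * n := fun t => by
    have := Nat.even_mul_succ_self t
    obtain ⟨r, hr⟩ := this
    omega
  unfold psiC
  simp only [key]
  split_ifs with h
  · obtain ⟨t, ht⟩ := h
    rw [sum_eq_single t]
    · simp [ht]
    · intro b _ hb
      rw [if_neg]
      intro h2
      apply hb
      rw [← ht] at h2
      rcases lt_trichotomy b t with h | h | h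
      · nlinarith
      · exact h
      · nlinarith
    · intro h2
      exfalso; apply h2
      rw [mem_range]
      by_contra h3
      have : t * 2 ≤ t * (t + 1) := Nat.mul_le_mul_left _ (by omega)
      omega
  · exact sum_eq_zero fun t _ => if_neg fun h2 => h ⟨t, h2⟩

theorem psiC_one (m : ℕ) : psiC (3 * m + 1) = if 3 ∣ m then psiC (m / 3) else 0 := by
  have h1 : (∃ t, t * (t + 1) = 2 * (3 * m + 1)) ↔ 3 ∣ m ∧ ∃ t, t * (t + 1) = 2 * (m / 3) := by
    constructor
    · rintro ⟨t, ht⟩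
      obtain ⟨s, hs | hs | hs⟩ : ∃ s, t = 3 * s ∨ t = 3 * s + 1 ∨ t = 3 * s + 2 :=
        ⟨t / 3, by omega⟩
      · subst hs
        exfalso
        have : 3 * s * (3 * s + 1) = 3 * (s * (3 * s + 1)) := by ring
        omega
      · subst hs
        have e : (3 * s + 1) * (3 * s + 1 + 1) = 9 * (s * (s + 1)) + 2 := by ring
        exact ⟨by omega, s, by omega⟩
      · subst hs
        exfalso
        have : (3 * s + 2) * (3 * s + 2 + 1) = 3 * ((3 * s + 2) * (s + 1)) := by ring
        omega
    · rintro ⟨hm, s, hs⟩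
      have e : (3 * s + 1) * (3 * s + 1 + 1) = 9 * (s * (s + 1)) + 2 := by ring
      exact ⟨3 * s + 1, by omega⟩
  rw [psiC_eq, psiC_eq]
  by_cases h : ∃ t, t * (t + 1) = 2 * (3 * m + 1)
  · have h2 := h1.mp h
    rw [if_pos h, if_pos h2.1, if_pos h2.2]
  · rw [if_neg h]
    split_ifs with h3 h4
    · exact absurd (h1.mpr ⟨h3, h4⟩) h
    · rfl
    · rfl

theorem psiC_two (m : ℕ) : psiC (3 * m + 2) = 0 := by
  rw [psiC_eq, if_neg]
  rintro ⟨t, ht⟩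
  obtain ⟨s, hs | hs | hs⟩ : ∃ s, t = 3 * s ∨ t = 3 * s + 1 ∨ t = 3 * s + 2 :=
    ⟨t / 3, by omega⟩
  · subst hs
    have : 3 * s * (3 * s + 1) = 3 * (s * (3 * s + 1)) := by ring
    omega
  · subst hs
    have e : (3 * s + 1) * (3 * s + 1 + 1) = 9 * (s * (s + 1)) + 2 := by ring
    omega
  · subst hs
    have : (3 * s + 2) * (3 * s + 2 + 1) = 3 * ((3 * s + 2) * (s + 1)) := by ring
    omega

/-- Solutions of `8 x² + y² = N`. -/
noncomputable def Z (N : ℕ) : Finset (ℤ × ℤ) :=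
  (Icc (-((2 * N : ℕ) : ℤ)) ((2 * N : ℕ) : ℤ) ×ˢ Icc (-((2 * N : ℕ) : ℤ)) ((2 * N : ℕ) : ℤ)).filter
    fun p => 8 * p.1 ^ 2 + p.2 ^ 2 = (N : ℤ)

theorem mem_Z (N : ℕ) (p : ℤ × ℤ) : p ∈ Z N ↔ 8 * p.1 ^ 2 + p.2 ^ 2 = (N : ℤ) := by
  unfold Z
  rw [mem_filter, mem_product, mem_Icc, mem_Icc]
  constructor
  · exact fun h => h.2
  · intro h
    have h1 := Int.le_self_sq p.1
    have h2 := Int.le_self_sq (-p.1)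
    have h3 := Int.le_self_sq p.2
    have h4 := Int.le_self_sq (-p.2)
    rw [neg_sq] at h2 h4
    push_cast
    have h5 := sq_nonneg p.1
    have h6 := sq_nonneg p.2
    refine ⟨⟨⟨?_, ?_⟩, ?_, ?_⟩, h⟩ <;> linarith

noncomputable def W (N : ℕ) : ZMod 3 := ∑ p ∈ Z N, (-1) ^ p.1.natAbs

theorem two_psiC (j K : ℕ) (h : j < K) :
    2 * psiC j = ∑ y ∈ Icc (-((2 * K : ℕ) : ℤ)) ((2 * K : ℕ) : ℤ),
      if y ^ 2 = 8 * (j : ℤ) + 1 then (1 : ZMod 3) else 0 := by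
  rw [psiC_box j K h, sum_Icc_symm, mul_sum, if_neg (by omega), zero_add,
    sum_range_two_mul]
  have : ∀ k ∈ range K, ((if (((2 * k + 1 : ℕ) : ℤ) + 1) ^ 2 = 8 * (j : ℤ) + 1 then (1 : ZMod 3) else 0)
      + if (-(((2 * k + 1 : ℕ) : ℤ) + 1)) ^ 2 = 8 * (j : ℤ) + 1 then (1 : ZMod 3) else 0) = 0 := by
    intro k _
    rw [neg_sq, if_neg, add_zero]
    intro h
    have e : (((2 * k + 1 : ℕ) : ℤ) + 1) ^ 2 = 2 * (2 * ((k : ℤ) + 1) ^ 2) := by push_cast; ring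
    omega
  rw [sum_eq_zero this, zero_add]
  refine sum_congr rfl fun k _ => ?_
  have e1 : (((2 * k : ℕ) : ℤ) + 1) ^ 2 = 8 * (j : ℤ) + 1 ↔ k * (k + 1) / 2 = j := by
    obtain ⟨r, hr⟩ := Nat.even_mul_succ_self k
    have e : (((2 * k : ℕ) : ℤ) + 1) ^ 2 = 4 * ((k * (k + 1) : ℕ) : ℤ) + 1 := by push_cast; ring
    rw [e]
    omega
  rw [neg_sq]
  simp only [e1]
  split_ifs <;> norm_num

open PowerSeries in
theorem two_coeff (n : ℕ) : 2 * coeff n (Phi * Psi) = W (8 * n + 1) := by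
  set B := Icc (-((2 * (8 * n + 1) : ℕ) : ℤ)) ((2 * (8 * n + 1) : ℕ) : ℤ) with hB
  rw [coeff_mul, mul_sum]
  have h1 : ∀ p ∈ antidiagonal n, 2 * (coeff p.1 Phi * coeff p.2 Psi) =
      ∑ x ∈ B, ∑ y ∈ B, if x ^ 2 = (p.1 : ℤ) ∧ y ^ 2 = 8 * (p.2 : ℤ) + 1
        then (-1 : ZMod 3) ^ x.natAbs else 0 := by
    intro p hp
    rw [HasAntidiagonal.mem_antidiagonal] at hp
    rw [Phi, Psi, coeff_mk, coeff_mk, mul_left_comm, two_psiC p.2 (8 * n + 1) (by omega),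
      phiC_box p.1 (2 * (8 * n + 1)) (by omega), sum_mul_sum]
    refine sum_congr rfl fun x _ => sum_congr rfl fun y _ => ?_
    split_ifs <;> simp_all
  rw [sum_congr rfl h1, sum_comm]
  unfold W Z
  rw [sum_filter, sum_product]
  refine sum_congr rfl fun x _ => ?_
  rw [sum_comm]
  refine sum_congr rfl fun y _ => ?_
  dsimp only
  split_ifs with h
  · obtain ⟨i, hi⟩ : ∃ i : ℕ, x ^ 2 = (i : ℤ) := ⟨(x ^ 2).toNat, by
      rw [Int.toNat_of_nonneg (sq_nonneg x)]⟩
    have hy := sq_nonneg y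
    push_cast at h
    rw [sum_eq_single (i, n - i)]
    · rw [if_pos]
      refine ⟨hi, ?_⟩
      dsimp only
      omega
    · rintro ⟨a, b⟩ hab hne
      rw [HasAntidiagonal.mem_antidiagonal] at hab
      rw [if_neg]
      rintro ⟨h2, h3⟩
      apply hne
      dsimp only at *
      rw [Prod.mk.injEq]
      omega
    · intro h2
      exfalso; apply h2
      rw [HasAntidiagonal.mem_antidiagonal]
      dsimp only
      omega
  · refine sum_eq_zero fun p hp => if_neg ?_
    rw [HasAntidiagonal.mem_antidiagonal] at hp
    rintro ⟨h2, h3⟩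
    apply h
    push_cast
    omega

theorem parity_flip (a b : ℤ) (h : Odd (a + b)) :
    (-1 : ZMod 3) ^ a.natAbs + (-1) ^ b.natAbs = 0 := by
  rcases Int.even_or_odd a with ha | ha
  · have hb : Odd b := by
      rcases Int.even_or_odd b with hb | hb
      · exact absurd (ha.add hb) (Int.not_even_iff_odd.mpr h)
      · exact hb
    rw [(Int.natAbs_even.mpr ha).neg_one_pow, (Int.natAbs_odd.mpr hb).neg_one_pow]; ring
  · have hb : Even b := by
      rcases Int.even_or_odd b with hb | hb
      · exact hb
      · exact absurd (ha.add_odd hb) (Int.not_even_iff_odd.mpr h)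
    rw [(Int.natAbs_odd.mpr ha).neg_one_pow, (Int.natAbs_even.mpr hb).neg_one_pow]; ring

theorem S_zero (N : ℕ) (hN : Odd N) :
    ∑ p ∈ (Z N).filter (fun p => (3 : ℤ) ∣ p.2 - p.1), (-1 : ZMod 3) ^ p.1.natAbs = 0 := by
  have hodd : ∀ x k : ℤ, 8 * x ^ 2 + (x + 3 * k) ^ 2 = (N : ℤ) → Odd (x + -k) := by
    intro x k h
    have h1 : Odd (8 * x ^ 2 + (x + 3 * k) ^ 2) := by rw [h]; exact_mod_cast hN
    by_contra h2
    rw [Int.not_odd_iff_even] at h2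
    obtain ⟨r, hr⟩ := h2
    obtain ⟨s, hs⟩ := h1
    obtain rfl : x = k + 2 * r := by omega
    have e : 8 * (k + 2 * r) ^ 2 + (k + 2 * r + 3 * k) ^ 2
        = 2 * (4 * (k + 2 * r) ^ 2 + 2 * (2 * k + r) ^ 2) := by ring
    omega
  refine sum_involution (fun p _ => ((p.1 - p.2) / 3, -((p.2 - p.1) / 3 + 3 * p.1))) ?_ ?_ ?_ ?_
  · rintro ⟨x, y⟩ hp
    rw [mem_filter, mem_Z] at hp
    obtain ⟨h, k, hk⟩ := hp
    dsimp only at *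
    obtain rfl : y = x + 3 * k := by omega
    rw [show (x - (x + 3 * k)) / 3 = -k by omega]
    exact parity_flip _ _ (hodd x k h)
  · rintro ⟨x, y⟩ hp _ heq
    rw [mem_filter, mem_Z] at hp
    obtain ⟨h, k, hk⟩ := hp
    dsimp only at *
    obtain rfl : y = x + 3 * k := by omega
    have h2 := hodd x k h
    rw [Prod.mk.injEq] at heq
    obtain ⟨r, hr⟩ := h2
    omega
  · rintro ⟨x, y⟩ hp
    rw [mem_filter, mem_Z] at hp ⊢
    obtain ⟨h, k, hk⟩ := hp
    dsimp only at *
    obtain rfl : y = x + 3 * k := by omega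
    rw [show (x - (x + 3 * k)) / 3 = -k by omega, show (x + 3 * k - x) / 3 = k by omega]
    refine ⟨?_, ⟨-x, by ring⟩⟩
    rw [← h]; ring
  · rintro ⟨x, y⟩ hp
    rw [mem_filter, mem_Z] at hp
    obtain ⟨h, k, hk⟩ := hp
    dsimp only at *
    rw [Prod.mk.injEq]
    omega

theorem S_zero' (N : ℕ) (hN : Odd N) :
    ∑ p ∈ (Z N).filter (fun p => (3 : ℤ) ∣ p.2 + p.1), (-1 : ZMod 3) ^ p.1.natAbs = 0 := by
  rw [← S_zero N hN]
  refine sum_nbij' (fun p => (-p.1, p.2)) (fun p => (-p.1, p.2)) ?_ ?_ ?_ ?_ ?_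
  · intro p; simp [mem_filter, mem_Z]
  · intro p; simp [mem_filter, mem_Z]; intro h1 h2; exact ⟨h1, by rwa [← sub_eq_add_neg]⟩
  · intro p; simp
  · intro p; simp
  · intro p; simp

theorem W_three (m : ℕ) : W (24 * m + 9) =
    - ∑ p ∈ (Z (24 * m + 9)).filter (fun p => (3 : ℤ) ∣ p.1 ∧ (3 : ℤ) ∣ p.2),
      (-1 : ZMod 3) ^ p.1.natAbs := by
  have hN : Odd (24 * m + 9) := ⟨12 * m + 4, by ring⟩
  have h1 := S_zero _ hN
  have h2 := S_zero' _ hN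
  rw [sum_filter] at h1 h2
  rw [sum_filter]
  suffices h : W (24 * m + 9) -
      (∑ a ∈ Z (24 * m + 9), if (3 : ℤ) ∣ a.2 - a.1 then (-1 : ZMod 3) ^ a.1.natAbs else 0) -
      (∑ a ∈ Z (24 * m + 9), if (3 : ℤ) ∣ a.2 + a.1 then (-1 : ZMod 3) ^ a.1.natAbs else 0) +
      (∑ a ∈ Z (24 * m + 9), if (3 : ℤ) ∣ a.1 ∧ (3 : ℤ) ∣ a.2 then
        (-1 : ZMod 3) ^ a.1.natAbs else 0) = 0 by
    rw [h1, h2, sub_zero, sub_zero] at h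
    exact eq_neg_of_add_eq_zero_left h
  rw [W, ← sum_sub_distrib, ← sum_sub_distrib, ← sum_add_distrib]
  refine sum_eq_zero ?_
  rintro ⟨x, y⟩ hp
  rw [mem_Z] at hp
  dsimp only at *
  push_cast at hp
  have key : (3 : ℤ) ∣ (y - x) * (y + x) := ⟨8 * m + 3 - 3 * x ^ 2, by linear_combination hp⟩
  rcases Int.Prime.dvd_mul' Nat.prime_three key with h | h
  · push_cast at h
    by_cases h3 : (3 : ℤ) ∣ y + x
    · rw [if_pos h, if_pos h3, if_pos (by omega)]; ring
    · rw [if_pos h, if_neg h3, if_neg (by omega)]; ring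
  · push_cast at h
    by_cases h3 : (3 : ℤ) ∣ y - x
    · rw [if_pos h, if_pos h3, if_pos (by omega)]; ring
    · rw [if_pos h, if_neg h3, if_neg (by omega)]; ring

theorem W_nine (n : ℕ) :
    ∑ p ∈ (Z (24 * (3 * n) + 9)).filter (fun p => (3 : ℤ) ∣ p.1 ∧ (3 : ℤ) ∣ p.2),
      (-1 : ZMod 3) ^ p.1.natAbs = W (8 * n + 1) := by
  unfold W
  symm
  refine sum_nbij' (fun p => (3 * p.1, 3 * p.2)) (fun p => (p.1 / 3, p.2 / 3)) ?_ ?_ ?_ ?_ ?_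
  · rintro ⟨x, y⟩ h
    rw [mem_filter, mem_Z]
    rw [mem_Z] at h
    dsimp only at *
    push_cast at *
    exact ⟨by linear_combination 9 * h, ⟨x, rfl⟩, ⟨y, rfl⟩⟩
  · rintro ⟨x, y⟩ h
    rw [mem_filter, mem_Z] at h
    rw [mem_Z]
    obtain ⟨h, ⟨a, ha⟩, ⟨b, hb⟩⟩ := h
    dsimp only at *
    subst ha hb
    push_cast at *
    rw [show 3 * a / 3 = a by omega, show 3 * b / 3 = b by omega]
    linarith
  · rintro ⟨x, y⟩ h
    rw [Prod.mk.injEq]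
    dsimp only
    omega
  · rintro ⟨x, y⟩ h
    rw [mem_filter, mem_Z] at h
    rw [Prod.mk.injEq]
    dsimp only at *
    omega
  · rintro ⟨x, y⟩ h
    dsimp only
    rw [Int.natAbs_mul, pow_mul]
    norm_num

theorem W_not_nine (m : ℕ) (hm : ¬ 3 ∣ m) :
    ∑ p ∈ (Z (24 * m + 9)).filter (fun p => (3 : ℤ) ∣ p.1 ∧ (3 : ℤ) ∣ p.2),
      (-1 : ZMod 3) ^ p.1.natAbs = 0 := by
  refine sum_eq_zero ?_
  rintro ⟨x, y⟩ h
  rw [mem_filter, mem_Z] at h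
  obtain ⟨h, ⟨a, ha⟩, ⟨b, hb⟩⟩ := h
  dsimp only at *
  subst ha hb
  exfalso
  have e : 8 * (3 * a) ^ 2 + (3 * b) ^ 2 = 9 * (8 * a ^ 2 + b ^ 2) := by ring
  rw [e] at h
  push_cast at h
  omega

/-- The subsequence of coefficients with index `3 n + r`. -/
noncomputable def U (r : ℕ) (f : PowerSeries (ZMod 3)) : PowerSeries (ZMod 3) :=
  PowerSeries.mk fun n => PowerSeries.coeff (3 * n + r) f

noncomputable abbrev ex (f : PowerSeries (ZMod 3)) : PowerSeries (ZMod 3) :=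
  PowerSeries.expand 3 (by norm_num) f

open PowerSeries in
theorem U_PhiPsi : U 1 (Phi * Psi) = - ex (Phi * Psi) := by
  ext m
  rw [U, coeff_mk, map_neg, ex, coeff_expand]
  have h : ∀ a b : ZMod 3, 2 * a = - (2 * b) → a = - b := by decide
  have h0 : ∀ a : ZMod 3, 2 * a = 0 → a = 0 := by decide
  have e := two_coeff (3 * m + 1)
  rw [show 8 * (3 * m + 1) + 1 = 24 * m + 9 by ring, W_three] at e
  split_ifs with hm
  · obtain ⟨n, rfl⟩ := hm
    rw [Nat.mul_div_cancel_left _ (by norm_num)]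
    apply h
    rw [e, W_nine, two_coeff]
  · rw [W_not_nine m hm, neg_zero] at e
    rw [neg_zero]
    exact h0 _ e

open PowerSeries in
theorem U_one_Psi : U 1 Psi = ex Psi := by
  ext m
  rw [U, coeff_mk, ex, coeff_expand, Psi, coeff_mk, coeff_mk, psiC_one]

open PowerSeries in
theorem U_two_Psi : U 2 Psi = 0 := by
  ext m
  rw [U, coeff_mk, Psi, coeff_mk, psiC_two, map_zero]

open PowerSeries in
theorem U_decomp (f : PowerSeries (ZMod 3)) :
    f = ex (U 0 f) + X * ex (U 1 f) + X ^ 2 * ex (U 2 f) := by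
  ext n
  simp only [map_add]
  obtain ⟨m, h | h | h⟩ : ∃ m, n = 3 * m ∨ n = 3 * m + 1 ∨ n = 3 * m + 2 := ⟨n / 3, by omega⟩
  · subst h
    rw [coeff_X_pow_mul', coeff_expand_mul, U, coeff_mk]
    rcases m with _ | m
    · simp
    · rw [show 3 * (m + 1) = (3 * m + 2) + 1 by ring, coeff_succ_X_mul,
        coeff_expand_of_not_dvd _ _ _ (by omega), if_pos (by omega),
        coeff_expand_of_not_dvd _ _ _ (by omega)]
      simp
  · subst h
    rw [coeff_X_pow_mul', coeff_succ_X_mul, coeff_expand_mul,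
      coeff_expand_of_not_dvd _ _ _ (by omega), U, coeff_mk]
    split_ifs
    · rw [coeff_expand_of_not_dvd _ _ _ (by omega)]; simp
    · simp
  · subst h
    rw [coeff_X_pow_mul, coeff_expand_mul, coeff_succ_X_mul,
      coeff_expand_of_not_dvd _ _ _ (by omega), coeff_expand_of_not_dvd _ _ _ (by omega), U,
      coeff_mk]
    simp

open PowerSeries in
theorem U_comp (f0 f1 f2 : PowerSeries (ZMod 3)) :
    U 0 (ex f0 + X * ex f1 + X ^ 2 * ex f2) = f0 ∧
    U 1 (ex f0 + X * ex f1 + X ^ 2 * ex f2) = f1 ∧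
    U 2 (ex f0 + X * ex f1 + X ^ 2 * ex f2) = f2 := by
  refine ⟨?_, ?_, ?_⟩ <;> ext m <;> rw [U, coeff_mk] <;> simp only [map_add]
  · rw [add_zero, coeff_X_pow_mul', coeff_expand_mul]
    rcases m with _ | m
    · simp
    · rw [show 3 * (m + 1) = (3 * m + 2) + 1 by ring, coeff_succ_X_mul,
        coeff_expand_of_not_dvd _ _ _ (by omega), if_pos (by omega),
        coeff_expand_of_not_dvd _ _ _ (by omega)]
      simp
  · rw [coeff_X_pow_mul', coeff_succ_X_mul, coeff_expand_mul,
      coeff_expand_of_not_dvd _ _ _ (by omega)]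
    split_ifs
    · rw [coeff_expand_of_not_dvd _ _ _ (by omega)]; simp
    · simp
  · rw [coeff_X_pow_mul, coeff_expand_mul, coeff_succ_X_mul,
      coeff_expand_of_not_dvd _ _ _ (by omega), coeff_expand_of_not_dvd _ _ _ (by omega)]
    simp

theorem U_mul_ex (f g : PowerSeries (ZMod 3)) :
    U 0 (f * ex g) = U 0 f * g ∧ U 1 (f * ex g) = U 1 f * g ∧ U 2 (f * ex g) = U 2 f * g := by
  have h := U_comp (U 0 f * g) (U 1 f * g) (U 2 f * g)
  have e : f * ex g = ex (U 0 f * g) + PowerSeries.X * ex (U 1 f * g)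
      + PowerSeries.X ^ 2 * ex (U 2 f * g) := by
    conv_lhs => rw [U_decomp f]
    simp only [ex, map_mul]
    ring
  rw [e]; exact h

theorem U_two_Psi_sq : U 2 (Psi ^ 2) = (ex Psi) ^ 2 := by
  have e : Psi ^ 2 = ex (U 0 Psi ^ 2) + PowerSeries.X * ex (2 * U 0 Psi * ex Psi)
      + PowerSeries.X ^ 2 * ex ((ex Psi) ^ 2) := by
    conv_lhs => rw [U_decomp Psi, U_one_Psi, U_two_Psi]
    simp only [ex, map_mul, map_pow, map_zero, map_ofNat]
    ring
  rw [e]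
  exact (U_comp _ _ _).2.2

theorem ex_eq_cube (f : PowerSeries (ZMod 3)) : ex f = f ^ 3 := by
  have : Fact (Nat.Prime 3) := ⟨Nat.prime_three⟩
  have h := MvPowerSeries.map_frobenius_expand (σ := Unit) (R := ZMod 3) 3 (by norm_num) (f := f)
  rw [ZMod.frobenius_zmod, MvPowerSeries.map_id] at h
  exact h

theorem Phi_ne : Phi ≠ 0 := by
  intro h
  have := congrArg (PowerSeries.coeff 0) h
  rw [Phi, PowerSeries.coeff_mk] at this
  simp [phiC] at this

theorem final_alg (A : PowerSeries (ZMod 3)) (h : A * Phi ^ 8 = Psi ^ 7) :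
    U 1 (U 2 (U 1 A)) = U 1 A := by
  have h1 : A * ex (ex Phi) = Phi * Psi * ex (Psi ^ 2) := by
    rw [ex_eq_cube, ex_eq_cube, ex_eq_cube]
    linear_combination Phi * h
  have h2 : U 1 A = - (Psi ^ 2 * ex Psi) := by
    have h3 := (U_mul_ex A (ex Phi)).2.1
    rw [h1, (U_mul_ex _ _).2.1, U_PhiPsi] at h3
    have h4 : ex Phi ≠ 0 := by rw [ex_eq_cube]; exact pow_ne_zero _ Phi_ne
    apply mul_right_cancel₀ h4
    rw [← h3]
    simp only [ex, map_mul]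
    ring
  have hneg : ∀ (r : ℕ) (f : PowerSeries (ZMod 3)), U r (-f) = - U r f := by
    intro r f; ext m; simp [U]
  rw [h2, hneg, (U_mul_ex _ _).2.2, U_two_Psi_sq, hneg, mul_comm, ← map_pow (PowerSeries.expand 3 _) Psi,
    (U_mul_ex _ _).2.1, U_one_Psi, mul_comm]

/-- Multisets supported on `I` with first coordinates summing to `n`. -/
def MS (I : Finset (ℕ × ℕ)) (n : ℕ) : Set (Multiset (ℕ × ℕ)) :=
  {s | (∀ p ∈ s, p ∈ I) ∧ (s.map Prod.fst).sum = n}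

theorem MS_finite (I : Finset (ℕ × ℕ)) (hI : ∀ p ∈ I, 0 < p.1) (n : ℕ) : (MS I n).Finite := by
  refine (Set.finite_Iic (n • I.val)).subset ?_
  rintro s ⟨h1, h2⟩
  rw [Set.mem_Iic, Multiset.le_iff_count]
  intro p
  by_cases hp : p ∈ s
  · have hpI := h1 p hp
    rw [Multiset.count_nsmul, Multiset.count_eq_one_of_mem I.nodup hpI, mul_one]
    have h3 : Multiset.card s ≤ n := by
      rw [← h2]
      have := Multiset.card_nsmul_le_sum (s := s.map Prod.fst) (a := 1) (by
        intro x hx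
        rw [Multiset.mem_map] at hx
        obtain ⟨q, hq, rfl⟩ := hx
        exact hI q (h1 q hq))
      simpa using this
    exact (Multiset.count_le_card p s).trans h3
  · rw [Multiset.count_eq_zero_of_notMem hp]; exact Nat.zero_le _

theorem MS_insert (I : Finset (ℕ × ℕ)) (p : ℕ × ℕ) (hp : p ∉ I) (hI : ∀ q ∈ insert p I, 0 < q.1)
    (n : ℕ) : (MS (insert p I) n).ncard =
      (MS I n).ncard + if p.1 ≤ n then (MS (insert p I) (n - p.1)).ncard else 0 := by
  have hfin : (MS I n).Finite := MS_finite I (fun q hq => hI q (mem_insert_of_mem hq)) n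
  split_ifs with h
  · have e : MS (insert p I) n = MS I n ∪ (fun s => p ::ₘ s) '' MS (insert p I) (n - p.1) := by
      ext s
      constructor
      · rintro ⟨h1, h2⟩
        by_cases hs : p ∈ s
        · right
          obtain ⟨t, rfl⟩ := Multiset.exists_cons_of_mem hs
          refine ⟨t, ⟨fun q hq => h1 q (Multiset.mem_cons_of_mem hq), ?_⟩, rfl⟩
          rw [Multiset.map_cons, Multiset.sum_cons] at h2
          omega
        · left
          refine ⟨fun q hq => ?_, h2⟩
          rcases mem_insert.mp (h1 q hq) with rfl | h3
          · exact absurd hq hs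
          · exact h3
      · rintro (⟨h1, h2⟩ | ⟨t, ⟨h1, h2⟩, rfl⟩)
        · exact ⟨fun q hq => mem_insert_of_mem (h1 q hq), h2⟩
        · refine ⟨fun q hq => ?_, ?_⟩
          · rcases Multiset.mem_cons.mp hq with rfl | h3
            · exact mem_insert_self _ _
            · exact h1 q h3
          · rw [Multiset.map_cons, Multiset.sum_cons, h2]; omega
    rw [e, Set.ncard_union_eq _ hfin ((MS_finite _ hI _).image _),
      Set.ncard_image_of_injective _ (fun s t h => (Multiset.cons_inj_right p).mp h)]
    rw [Set.disjoint_left]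
    rintro s ⟨h1, _⟩ ⟨t, _, rfl⟩
    exact hp (h1 p (Multiset.mem_cons_self _ _))
  · rw [add_zero]
    congr 1
    ext s
    constructor
    · rintro ⟨h1, h2⟩
      refine ⟨fun q hq => ?_, h2⟩
      rcases mem_insert.mp (h1 q hq) with rfl | h3
      · exfalso
        obtain ⟨t, rfl⟩ := Multiset.exists_cons_of_mem hq
        rw [Multiset.map_cons, Multiset.sum_cons] at h2
        omega
      · exact h3
    · rintro ⟨h1, h2⟩
      exact ⟨fun q hq => mem_insert_of_mem (h1 q hq), h2⟩

open PowerSeries in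
theorem MS_gen (I : Finset (ℕ × ℕ)) (hI : ∀ p ∈ I, 0 < p.1) :
    (PowerSeries.mk fun n => ((MS I n).ncard : ZMod 3)) * ∏ p ∈ I, (1 - X ^ p.1) = 1 := by
  induction I using Finset.induction_on with
  | empty =>
    rw [prod_empty, mul_one]
    ext n
    rw [coeff_mk, coeff_one]
    split_ifs with h
    · subst h
      have : MS ∅ 0 = {0} := by
        ext s
        constructor
        · rintro ⟨h1, _⟩
          exact Multiset.eq_zero_of_forall_notMem fun q hq => absurd (h1 q hq) (by simp)
        · rintro rfl
          exact ⟨by simp, by simp⟩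
      rw [this]; simp
    · have : MS ∅ n = ∅ := by
        ext s
        simp only [Set.mem_empty_iff_false, iff_false]
        rintro ⟨h1, h2⟩
        have : s = 0 := Multiset.eq_zero_of_forall_notMem fun q hq => absurd (h1 q hq) (by simp)
        subst this
        simp at h2
        omega
      rw [this]; simp
  | insert p I hp ih =>
    refine Eq.trans ?_ (ih (fun q hq => hI q (mem_insert_of_mem hq)))
    rw [prod_insert hp, ← mul_assoc]
    refine congrArg (· * ∏ p ∈ I, (1 - X ^ p.1 : PowerSeries (ZMod 3))) ?_
    ext n
    rw [mul_sub, mul_one, map_sub, coeff_mul_X_pow', coeff_mk, coeff_mk, MS_insert I p hp hI n]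
    split_ifs with h
    · rw [coeff_mk]; push_cast; ring
    · simp

/-- Admissible parts of size at most `2 N`. -/
def parts (N : ℕ) : Finset (ℕ × ℕ) :=
  ((range N).image fun k => (2 * k + 2, 1)) ∪
    ((range N ×ˢ Icc 1 23).image fun q => (2 * q.1 + 1, q.2))

theorem mem_parts (N : ℕ) (p : ℕ × ℕ) : p ∈ parts N ↔
    p.1 ≤ 2 * N ∧ (0 < p.1 ∧ 1 ≤ p.2 ∧ p.2 ≤ 23 ∧ (Even p.1 → p.2 = 1)) := by
  obtain ⟨m, c⟩ := p
  simp only [parts, mem_union, mem_image, mem_range, mem_product, mem_Icc, Prod.mk.injEq,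
    Prod.exists]
  constructor
  · rintro (⟨k, hk, rfl, rfl⟩ | ⟨k, d, ⟨hk, h1, h2⟩, rfl, rfl⟩)
    · refine ⟨by omega, by omega, by omega, by omega, fun _ => rfl⟩
    · refine ⟨by omega, by omega, by omega, by omega, fun h => ?_⟩
      rw [Nat.even_iff] at h
      omega
  · rintro ⟨h1, h2, h3, h4, h5⟩
    rcases Nat.even_or_odd m with he | ho
    · left
      have h6 := h5 he
      rw [Nat.even_iff] at he
      exact ⟨m / 2 - 1, by omega, by omega, by omega⟩
    · right
      rw [Nat.odd_iff] at ho
      exact ⟨m / 2, c, by omega, by omega, rfl⟩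

theorem prod_parts {R : Type*} [CommRing R] (x : R) (N : ℕ) : ∏ p ∈ parts N, (1 - x ^ p.1) =
    (∏ k ∈ range N, (1 - x ^ (2 * k + 2))) * (∏ k ∈ range N, (1 - x ^ (2 * k + 1))) ^ 23 := by
  rw [parts, prod_union, prod_image, prod_image, prod_product, ← prod_pow]
  · simp
  · rintro ⟨a, b⟩ _ ⟨c, d⟩ _ h
    simp only [Prod.mk.injEq] at h ⊢
    omega
  · intro a _ b _ h
    simp only [Prod.mk.injEq] at h
    omega
  · rw [disjoint_left]
    rintro p h1 h2
    simp only [mem_image, mem_range, mem_product] at h1 h2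
    obtain ⟨a, _, rfl⟩ := h1
    obtain ⟨b, _, h⟩ := h2
    simp only [Prod.mk.injEq] at h
    omega

theorem a_eq (N n : ℕ) (h : n < N) : a 23 n = (MS (parts N) n).ncard := by
  rw [a, Nat.card_coe_set_eq]
  congr 1
  ext s
  constructor
  · rintro ⟨h1, h2⟩
    refine ⟨fun p hp => (mem_parts N p).mpr ⟨?_, h1 p hp⟩, h2⟩
    have := Multiset.single_le_sum (s := s.map Prod.fst) (fun _ _ => Nat.zero_le _) p.1
      (Multiset.mem_map_of_mem _ hp)
    omega
  · rintro ⟨h1, h2⟩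
    exact ⟨fun p hp => ((mem_parts N p).mp (h1 p hp)).2, h2⟩

open PowerSeries in
theorem a_gen (N : ℕ) : (X : PowerSeries (ZMod 3)) ^ N ∣
    (PowerSeries.mk fun n => (a 23 n : ZMod 3)) *
      ((∏ k ∈ range N, (1 - X ^ (2 * k + 2))) * (∏ k ∈ range N, (1 - X ^ (2 * k + 1))) ^ 23) - 1 := by
  rw [← prod_parts]
  nth_rewrite 2 [← MS_gen (parts N) (fun p hp => ((mem_parts N p).mp hp).2.1)]
  rw [← sub_mul]
  refine Dvd.dvd.mul_right ?_ _
  rw [X_pow_dvd_iff]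
  intro m hm
  rw [map_sub, coeff_mk, coeff_mk, a_eq N m hm, sub_self]

end Stmt19

theorem stmt19 (n : ℕ) : a 23 (27 * n + 16) ≡ a 23 (3 * n + 1) [MOD 3] := by
  rw [← ZMod.natCast_eq_natCast_iff]
  have h := Stmt19.final_alg _ (Stmt19.main_product _ Stmt19.a_gen)
  have h2 := congrArg (PowerSeries.coeff n) h
  simp only [Stmt19.U, PowerSeries.coeff_mk] at h2
  rw [← h2]
  congr 2
  ring
end
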